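/- arXiv:1407.4512 — 3 statements merged into one kernel-verified Lean document; each statement's English description precedes it below -/
import Mathlib

section
/- Fix α ∈ (0,1) and let F be an absolutely continuous probability distribution on ℝ with continuous density f, strictly positive at q = F^{-1}(1−α). For each t > 0, let M_t, N_t be independent Poisson random variables with parameters αt and (1−α)t, and conditionally on M_t = m ≥ 1, N_t = n ≥ 1, let R_t be distributed as the spacing Z_(n+1) − Z_(n) between the n-th and (n+1)-th order statistics of an i.i.d. (n+m)-sample from F. Then, as t → ∞, the conditional law of t · f(q) · R_t given {M_t ≥ 1, N_t ≥ 1} converges weakly to the exponential distribution with parameter 1. -/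
open MeasureTheory ProbabilityTheory Filter Topology

/-- `F` is the distribution function of the continuous probability density `f`. -/
structure IsCDFOfDensity (f F : ℝ → ℝ) : Prop where
  nonneg : ∀ x, 0 ≤ f x
  integral_eq_one : ∫ x, f x = 1
  continuous_density : Continuous f
  eq_integral : ∀ x, F x = ∫ u in Set.Iic x, f u

namespace IsCDFOfDensity

variable {f F : ℝ → ℝ}

lemma integrable (h : IsCDFOfDensity f F) : Integrable f := by
  by_contra hf
  simpa [integral_undef hf] using h.integral_eq_one

lemma sub_eq_intervalIntegral (h : IsCDFOfDensity f F) (a b : ℝ) :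
    F b - F a = ∫ u in a..b, f u := by
  rw [h.eq_integral, h.eq_integral]
  exact intervalIntegral.integral_Iic_sub_Iic h.integrable.integrableOn h.integrable.integrableOn

lemma hasDerivAt (h : IsCDFOfDensity f F) (x : ℝ) : HasDerivAt F (f x) x := by
  have h1 : F = fun y => F 0 + ∫ u in (0 : ℝ)..y, f u := by
    funext y
    rw [← h.sub_eq_intervalIntegral]
    ring
  rw [h1]
  exact (h.continuous_density.integral_hasStrictDerivAt 0 x).hasDerivAt.const_add _

lemma continuous (h : IsCDFOfDensity f F) : Continuous F :=
  continuous_iff_continuousAt.2 fun x => (h.hasDerivAt x).continuousAt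

lemma monotone (h : IsCDFOfDensity f F) : Monotone F :=
  monotone_of_hasDerivAt_nonneg h.hasDerivAt h.nonneg

lemma cdf_nonneg (h : IsCDFOfDensity f F) (x : ℝ) : 0 ≤ F x := by
  rw [h.eq_integral]
  exact setIntegral_nonneg measurableSet_Iic fun u _ => h.nonneg u

lemma cdf_le_one (h : IsCDFOfDensity f F) (x : ℝ) : F x ≤ 1 := by
  rw [h.eq_integral, ← h.integral_eq_one]
  exact setIntegral_le_integral h.integrable (ae_of_all _ h.nonneg)

lemma one_sub_nonneg (h : IsCDFOfDensity f F) (x : ℝ) : 0 ≤ 1 - F x :=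
  sub_nonneg.2 (h.cdf_le_one x)

lemma tendsto_atTop (h : IsCDFOfDensity f F) : Tendsto F atTop (𝓝 1) := by
  have := (aecover_Iic (μ := volume) (tendsto_id (α := ℝ) (x := atTop))
    ).integral_tendsto_of_countably_generated h.integrable
  rw [h.integral_eq_one] at this
  exact this.congr fun x => (h.eq_integral x).symm

lemma tendsto_atBot (h : IsCDFOfDensity f F) : Tendsto F atBot (𝓝 0) := by
  have := (aecover_Ioi (μ := volume) (tendsto_id (α := ℝ) (x := atBot))
    ).integral_tendsto_of_countably_generated h.integrable
  rw [h.integral_eq_one] at this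
  have h2 := this.const_sub 1
  rw [sub_self] at h2
  refine h2.congr fun x => ?_
  have := intervalIntegral.integral_Iic_add_Ioi (b := x) h.integrable.integrableOn
    h.integrable.integrableOn
  rw [h.integral_eq_one, ← h.eq_integral] at this
  simp only [id]
  linarith

/-- A continuous weight with values in `[0, 1]` keeps the density integrable. -/
lemma integrable_mul (h : IsCDFOfDensity f F) {g : ℝ → ℝ} (hg : Continuous g)
    (h0 : ∀ u, 0 ≤ g u) (h1 : ∀ u, g u ≤ 1) : Integrable fun u => f u * g u :=
  h.integrable.mul_bdd (c := 1) hg.aestronglyMeasurable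
    (ae_of_all _ fun u => by simpa [abs_of_nonneg (h0 u)] using h1 u)

lemma pow_mul_pow_mem (h : IsCDFOfDensity f F) (a b : ℕ) (u v : ℝ) :
    0 ≤ F u ^ a * (1 - F v) ^ b ∧ F u ^ a * (1 - F v) ^ b ≤ 1 := by
  have h1 := h.one_sub_nonneg v
  have h2 := h.cdf_nonneg u
  have h3 := h.cdf_nonneg v
  refine ⟨by positivity, mul_le_one₀ (pow_le_one₀ h2 (h.cdf_le_one u)) (by positivity)
    (pow_le_one₀ h1 (by linarith))⟩

lemma integrable_shift (h : IsCDFOfDensity f F) (a b : ℕ) (y : ℝ) :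
    Integrable fun u => f u * (F u ^ a * (1 - F (u + y)) ^ b) := by
  have := h.continuous
  exact h.integrable_mul (by fun_prop) (fun u => (h.pow_mul_pow_mem a b u _).1)
    fun u => (h.pow_mul_pow_mem a b u _).2

lemma integrable_beta (h : IsCDFOfDensity f F) (a b : ℕ) :
    Integrable fun u => f u * (F u ^ a * (1 - F u) ^ b) := by
  simpa using h.integrable_shift a b 0

/-- The Beta integral in terms of the distribution function. -/
lemma integral_beta (h : IsCDFOfDensity f F) (a b : ℕ) :
    ∫ u, f u * (F u ^ a * (1 - F u) ^ b) =
      (a.factorial * b.factorial : ℝ) / (a + b + 1).factorial := by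
  induction b generalizing a with
  | zero =>
    have hd : ∀ x, HasDerivAt (fun u => F u ^ (a + 1) / (a + 1))
        (f x * (F x ^ a * (1 - F x) ^ 0)) x := by
      intro x
      refine (((h.hasDerivAt x).fun_pow (a + 1)).div_const ((a : ℝ) + 1)).congr_deriv ?_
      simp
      field_simp
    rw [integral_of_hasDerivAt_of_tendsto hd (h.integrable_beta a 0)
      ((h.tendsto_atBot.pow (a + 1)).div_const _) ((h.tendsto_atTop.pow (a + 1)).div_const _)]
    simp [Nat.factorial_succ]
    field_simp
  | succ b ih =>
    have hd : ∀ x, HasDerivAt (fun u => F u ^ (a + 1) * (1 - F u) ^ (b + 1))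
        ((a + 1) * (f x * (F x ^ a * (1 - F x) ^ (b + 1))) -
          (b + 1) * (f x * (F x ^ (a + 1) * (1 - F x) ^ b))) x := by
      intro x
      refine (((h.hasDerivAt x).fun_pow (a + 1)).fun_mul
        (((h.hasDerivAt x).const_sub 1).fun_pow (b + 1))).congr_deriv ?_
      simp
      ring
    have hi1 := (h.integrable_beta a (b + 1)).const_mul ((a : ℝ) + 1)
    have hi2 := (h.integrable_beta (a + 1) b).const_mul ((b : ℝ) + 1)
    have key := integral_of_hasDerivAt_of_tendsto hd (hi1.sub hi2)
      ((h.tendsto_atBot.pow (a + 1)).mul ((h.tendsto_atBot.const_sub 1).pow (b + 1)))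
      ((h.tendsto_atTop.pow (a + 1)).mul ((h.tendsto_atTop.const_sub 1).pow (b + 1)))
    rw [integral_sub hi1 hi2, integral_const_mul, integral_const_mul, ih (a + 1)] at key
    have ha : (a : ℝ) + 1 ≠ 0 := by positivity
    have e : a + 1 + b + 1 = a + (b + 1) + 1 := by ring
    rw [e] at key
    have key' := eq_of_sub_eq_zero (key.trans (by simp))
    rw [← mul_right_inj' ha, key', Nat.factorial_succ a, Nat.factorial_succ b]
    push_cast
    ring

/-- Integrating out the spacing variable. -/
lemma integral_shift_density (h : IsCDFOfDensity f F) (m : ℕ) (hm : 1 ≤ m) (u y : ℝ) :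
    ∫ δ in (0 : ℝ)..y, f (u + δ) * (1 - F (u + δ)) ^ (m - 1) =
      ((1 - F u) ^ m - (1 - F (u + y)) ^ m) / m := by
  have hc := h.continuous
  have hc' := h.continuous_density
  have hm' : (m : ℝ) ≠ 0 := by positivity
  have hd : ∀ x ∈ Set.uIcc 0 y, HasDerivAt (fun δ => -(1 - F (u + δ)) ^ m / m)
      (f (u + x) * (1 - F (u + x)) ^ (m - 1)) x := by
    intro x _
    have h1 : HasDerivAt (fun δ => F (u + δ)) (f (u + x)) x := by
      simpa using (h.hasDerivAt (u + x)).comp_const_add u x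
    refine ((h1.const_sub 1).fun_pow m).fun_neg.div_const (m : ℝ) |>.congr_deriv ?_
    field_simp
  rw [intervalIntegral.integral_eq_sub_of_hasDerivAt hd
    (Continuous.intervalIntegrable (by fun_prop) _ _)]
  simp
  ring

lemma integrable_spacing_prod (h : IsCDFOfDensity f F) (a b : ℕ) (y : ℝ) :
    Integrable (Function.uncurry fun δ u =>
      F u ^ a * f u * f (u + δ) * (1 - F (u + δ)) ^ b)
      ((volume.restrict (Set.uIoc 0 y)).prod volume) := by
  have hc := h.continuous
  have hc' := h.continuous_density
  have hg : Integrable (fun z : ℝ × ℝ => f z.2 * f (z.2 + z.1))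
      ((volume.restrict (Set.uIoc 0 y)).prod volume) := by
    have hsm : Continuous (fun z : ℝ × ℝ => f z.2 * f (z.2 + z.1)) := by fun_prop
    rw [integrable_prod_iff' hsm.aestronglyMeasurable]
    have hs : ∀ u, Integrable fun δ => f (u + δ) := fun u => h.integrable.comp_add_left u
    refine ⟨ae_of_all _ fun u => (hs u).restrict.const_mul (f u), ?_⟩
    refine h.integrable.mono' ?_ (ae_of_all _ fun u => ?_)
    · exact (hsm.aestronglyMeasurable (μ := (volume.restrict (Set.uIoc 0 y)).prod
        volume)).norm.prod_swap.integral_prod_right'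
    · have e : ∀ δ, ‖f u * f (u + δ)‖ = f u * f (u + δ) := fun δ =>
        Real.norm_of_nonneg (mul_nonneg (h.nonneg _) (h.nonneg _))
      simp only [e]
      rw [integral_const_mul, Real.norm_of_nonneg (mul_nonneg (h.nonneg _)
        (integral_nonneg fun _ => h.nonneg _))]
      refine mul_le_of_le_one_right (h.nonneg _) ?_
      calc ∫ δ in Set.uIoc 0 y, f (u + δ) ≤ ∫ δ, f (u + δ) :=
            setIntegral_le_integral (hs u) (ae_of_all _ fun _ => h.nonneg _)
        _ = 1 := by rw [integral_add_left_eq_self, h.integral_eq_one]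
  refine hg.mono' (Continuous.aestronglyMeasurable (by unfold Function.uncurry; fun_prop))
    (ae_of_all _ fun z => ?_)
  have hz := h.pow_mul_pow_mem a b z.2 (z.2 + z.1)
  have hf := mul_nonneg (h.nonneg z.2) (h.nonneg (z.2 + z.1))
  have e : Function.uncurry (fun δ u => F u ^ a * f u * f (u + δ) * (1 - F (u + δ)) ^ b) z =
      (f z.2 * f (z.2 + z.1)) * (F z.2 ^ a * (1 - F (z.2 + z.1)) ^ b) := by
    simp only [Function.uncurry]
    ring
  rw [e, Real.norm_of_nonneg (mul_nonneg hf hz.1)]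
  exact mul_le_of_le_one_right hf hz.2

end IsCDFOfDensity

/-- The density of the `n`-th order statistic of an `(n + m)`-sample. -/
noncomputable def orderDensity (f F : ℝ → ℝ) (m n : ℕ) (u : ℝ) : ℝ :=
  ((n + m).factorial : ℝ) / ((n - 1).factorial * m.factorial) *
    (f u * (F u ^ (n - 1) * (1 - F u) ^ m))

/-- The probability that the `n`-th spacing of an `(n + m)`-sample exceeds `y`. -/
noncomputable def spacingTail (f F : ℝ → ℝ) (m n : ℕ) (y : ℝ) : ℝ :=
  ((n + m).factorial : ℝ) / ((n - 1).factorial * m.factorial) *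
    ∫ u, f u * (F u ^ (n - 1) * (1 - F (u + y)) ^ m)

/-- The distribution function of the `n`-th spacing of an `(n + m)`-sample. -/
noncomputable def spacingCDF (f F : ℝ → ℝ) (m n : ℕ) (y : ℝ) : ℝ :=
  ∫ δ in Set.Iic y, (Set.Ioi (0 : ℝ)).indicator
    (fun δ => (((n + m).factorial : ℝ) /
        (((n - 1).factorial : ℝ) * ((m - 1).factorial : ℝ))) *
      ∫ u : ℝ, F u ^ (n - 1) * f u * f (u + δ) * (1 - F (u + δ)) ^ (m - 1)) δ

lemma spacingCDF_of_nonpos (f F : ℝ → ℝ) (m n : ℕ) {y : ℝ} (hy : y ≤ 0) :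
    spacingCDF f F m n y = 0 := by
  unfold spacingCDF
  refine setIntegral_eq_zero_of_forall_eq_zero fun δ hδ => Set.indicator_of_notMem ?_ _
  simp only [Set.mem_Ioi, not_lt]
  exact le_trans hδ hy

namespace IsCDFOfDensity

variable {f F : ℝ → ℝ}

lemma orderDensity_nonneg (h : IsCDFOfDensity f F) (m n : ℕ) (u : ℝ) :
    0 ≤ orderDensity f F m n u :=
  mul_nonneg (by positivity) (mul_nonneg (h.nonneg u) (h.pow_mul_pow_mem _ _ _ _).1)

lemma integrable_orderDensity_mul_pow (h : IsCDFOfDensity f F) (m n k : ℕ) :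
    Integrable fun u => orderDensity f F m n u * F u ^ k := by
  refine ((h.integrable_beta (n - 1 + k) m).const_mul
    (((n + m).factorial : ℝ) / ((n - 1).factorial * m.factorial))).congr (ae_of_all _ fun u => ?_)
  simp only [orderDensity, pow_add]
  ring

lemma integral_orderDensity_mul_pow (h : IsCDFOfDensity f F) (m n k : ℕ) :
    ∫ u, orderDensity f F m n u * F u ^ k =
      ((n + m).factorial : ℝ) / ((n - 1).factorial * m.factorial) *
        ((n - 1 + k).factorial * m.factorial / (n - 1 + k + m + 1).factorial) := by
  rw [← h.integral_beta, ← integral_const_mul]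
  refine integral_congr_ae (ae_of_all _ fun u => ?_)
  simp only [orderDensity, pow_add]
  ring

lemma integral_orderDensity (h : IsCDFOfDensity f F) (m n : ℕ) (hn : 1 ≤ n) :
    ∫ u, orderDensity f F m n u = 1 := by
  have := h.integral_orderDensity_mul_pow m n 0
  simp only [pow_zero, mul_one, add_zero] at this
  obtain ⟨n, rfl⟩ := Nat.exists_eq_add_of_le' hn
  rw [this, show n + 1 - 1 + m + 1 = n + 1 + m by omega]
  simp
  field_simp

/-- The second moment about `p` of the `n`-th uniform order statistic. -/
lemma integral_orderDensity_mul_sq (h : IsCDFOfDensity f F) (m n : ℕ) (hn : 1 ≤ n) (p : ℝ) :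
    ∫ u, orderDensity f F m n u * (F u - p) ^ 2 =
      n * (n + 1) / ((n + m + 1) * (n + m + 2)) - 2 * p * (n / (n + m + 1)) + p ^ 2 := by
  have i0 := h.integrable_orderDensity_mul_pow m n 0
  have i1 := h.integrable_orderDensity_mul_pow m n 1
  have i2 := h.integrable_orderDensity_mul_pow m n 2
  have e : ∀ u, orderDensity f F m n u * (F u - p) ^ 2 =
      orderDensity f F m n u * F u ^ 2 - 2 * p * (orderDensity f F m n u * F u ^ 1) +
        p ^ 2 * (orderDensity f F m n u * F u ^ 0) := fun u => by ring
  have i3 : Integrable fun u => orderDensity f F m n u * F u ^ 2 -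
      2 * p * (orderDensity f F m n u * F u ^ 1) := i2.sub (i1.const_mul _)
  simp only [e]
  rw [integral_add i3 (i0.const_mul _),
    integral_sub i2 (i1.const_mul _), integral_const_mul, integral_const_mul,
    h.integral_orderDensity_mul_pow, h.integral_orderDensity_mul_pow]
  simp only [pow_zero, mul_one]
  rw [h.integral_orderDensity m n hn]
  obtain ⟨n, rfl⟩ := Nat.exists_eq_add_of_le' hn
  rw [show n + 1 - 1 + 2 + m + 1 = (n + 1 + m) + 1 + 1 by omega,
    show n + 1 - 1 + 1 + m + 1 = (n + 1 + m) + 1 by omega]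
  simp only [add_tsub_cancel_right, Nat.factorial_succ]
  push_cast
  have := Nat.factorial_pos (n + 1 + m)
  field_simp
  ring

lemma spacingTail_nonneg (h : IsCDFOfDensity f F) (m n : ℕ) (y : ℝ) :
    0 ≤ spacingTail f F m n y :=
  mul_nonneg (by positivity) (integral_nonneg fun u =>
    mul_nonneg (h.nonneg u) (h.pow_mul_pow_mem _ _ _ _).1)

lemma spacingTail_zero (h : IsCDFOfDensity f F) (m n : ℕ) (hn : 1 ≤ n) :
    spacingTail f F m n 0 = 1 := by
  rw [← h.integral_orderDensity m n hn]
  simp [spacingTail, orderDensity, integral_const_mul]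

lemma spacingTail_le_one (h : IsCDFOfDensity f F) (m n : ℕ) (hn : 1 ≤ n) {y : ℝ} (hy : 0 ≤ y) :
    spacingTail f F m n y ≤ 1 := by
  rw [← h.spacingTail_zero m n hn]
  refine mul_le_mul_of_nonneg_left (integral_mono (h.integrable_shift _ _ _)
    (h.integrable_shift _ _ _) fun u => ?_) (by positivity)
  have h1 := h.monotone (show u + 0 ≤ u + y by linarith)
  have h2 := h.one_sub_nonneg (u + y)
  have h3 := h.nonneg u
  have h4 := h.cdf_nonneg u
  simp only
  gcongr

lemma spacingCDF_eq (h : IsCDFOfDensity f F) (m n : ℕ) (hm : 1 ≤ m) (hn : 1 ≤ n) {y : ℝ}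
    (hy : 0 ≤ y) : spacingCDF f F m n y = 1 - spacingTail f F m n y := by
  unfold spacingCDF
  rw [setIntegral_indicator measurableSet_Ioi, Set.inter_comm, Set.Ioi_inter_Iic,
    ← intervalIntegral.integral_of_le hy, intervalIntegral.integral_const_mul,
    intervalIntegral_integral_swap (h.integrable_spacing_prod _ _ _)]
  have e : ∀ u, ∫ δ in (0 : ℝ)..y, F u ^ (n - 1) * f u * f (u + δ) * (1 - F (u + δ)) ^ (m - 1) =
      (1 / m : ℝ) * (f u * (F u ^ (n - 1) * (1 - F (u + 0)) ^ m) -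
        f u * (F u ^ (n - 1) * (1 - F (u + y)) ^ m)) := by
    intro u
    simp only [mul_assoc (F u ^ (n - 1) * f u)]
    rw [intervalIntegral.integral_const_mul, h.integral_shift_density m hm, add_zero]
    ring
  simp only [e]
  rw [integral_const_mul, integral_sub (h.integrable_shift _ _ _) (h.integrable_shift _ _ _),
    show 1 - spacingTail f F m n y = spacingTail f F m n 0 - spacingTail f F m n y by
      rw [h.spacingTail_zero m n hn], spacingTail, spacingTail]
  generalize (∫ u, f u * (F u ^ (n - 1) * (1 - F (u + 0)) ^ m)) = A
  generalize (∫ u, f u * (F u ^ (n - 1) * (1 - F (u + y)) ^ m)) = B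
  obtain ⟨m, rfl⟩ := Nat.exists_eq_add_of_le' hm
  simp only [add_tsub_cancel_right, Nat.factorial_succ m]
  push_cast
  field_simp

lemma spacingCDF_mem (h : IsCDFOfDensity f F) (m n : ℕ) (hm : 1 ≤ m) (hn : 1 ≤ n) (y : ℝ) :
    0 ≤ spacingCDF f F m n y ∧ spacingCDF f F m n y ≤ 1 := by
  rcases le_total y 0 with hy | hy
  · simp [spacingCDF_of_nonpos f F m n hy]
  · rw [h.spacingCDF_eq m n hm hn hy]
    have := h.spacingTail_nonneg m n y
    have := h.spacingTail_le_one m n hn hy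
    constructor <;> linarith

end IsCDFOfDensity

lemma tendsto_one_add_pow_exp_of_tendsto_mul {ι : Type*} {l : Filter ι} {m : ι → ℕ} {w : ι → ℝ}
    {c : ℝ} (hw : Tendsto w l (𝓝 0)) (hmw : Tendsto (fun i => m i * w i) l (𝓝 c)) :
    Tendsto (fun i => (1 + w i) ^ m i) l (𝓝 (Real.exp c)) := by
  have hd : HasDerivAt (fun v : ℝ => Real.log (1 + v)) 1 0 := by
    simpa using ((hasDerivAt_id (0 : ℝ)).const_add 1).log (by simp)
  have ho : (fun i => Real.log (1 + w i) - w i) =o[l] w := by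
    have := (hasDerivAt_iff_isLittleO.1 hd).comp_tendsto hw
    simpa [Function.comp_def] using this
  have ho2 : (fun i => m i * (Real.log (1 + w i) - w i)) =o[l] (fun _ => (1 : ℝ)) :=
    ((Asymptotics.isBigO_refl (fun i => (m i : ℝ)) l).mul_isLittleO ho).trans_isBigO
      (hmw.isBigO_one ℝ)
  have hlog : Tendsto (fun i => m i * Real.log (1 + w i)) l (𝓝 c) := by
    have := ((Asymptotics.isLittleO_one_iff ℝ).1 ho2).add hmw
    rw [zero_add] at this
    exact this.congr fun i => by ring
  refine ((Real.continuous_exp.tendsto c).comp hlog).congr' ?_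
  filter_upwards [hw.eventually (lt_mem_nhds (show (-1 : ℝ) < 0 by norm_num))] with i hi
  rw [Function.comp_apply, Real.exp_nat_mul, Real.exp_log (by linarith)]

/-- The filter on triples `(t, m, n)` along which `t → ∞`, `m / t → α` and `n / t → p`. -/
noncomputable def ratioFilter (α p : ℝ) : Filter (ℝ × ℕ × ℕ) :=
  comap (fun z => (z.1, (z.2.1 / z.1 : ℝ), (z.2.2 / z.1 : ℝ))) (atTop ×ˢ (𝓝 α ×ˢ 𝓝 p))

section ratioFilter

variable (α p : ℝ)

lemma tendsto_time_ratioFilter : Tendsto (fun z : ℝ × ℕ × ℕ => z.1) (ratioFilter α p) atTop :=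
  tendsto_fst.comp (g := fun w : ℝ × ℝ × ℝ => w.1) tendsto_comap

lemma tendsto_fst_ratioFilter :
    Tendsto (fun z : ℝ × ℕ × ℕ => (z.2.1 / z.1 : ℝ)) (ratioFilter α p) (𝓝 α) :=
  (tendsto_fst.comp tendsto_snd).comp tendsto_comap

lemma tendsto_snd_ratioFilter :
    Tendsto (fun z : ℝ × ℕ × ℕ => (z.2.2 / z.1 : ℝ)) (ratioFilter α p) (𝓝 p) :=
  (tendsto_snd.comp tendsto_snd).comp tendsto_comap

variable {α p}

lemma eventually_one_le_ratioFilter (hα : 0 < α) (hp : 0 < p) :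
    ∀ᶠ z in ratioFilter α p, 1 ≤ z.2.1 ∧ 1 ≤ z.2.2 := by
  filter_upwards [(tendsto_fst_ratioFilter α p).eventually (lt_mem_nhds hα),
    (tendsto_snd_ratioFilter α p).eventually (lt_mem_nhds hp)] with z h1 h2
  constructor
  · rw [Nat.one_le_iff_ne_zero]
    rintro h
    simp [h] at h1
  · rw [Nat.one_le_iff_ne_zero]
    rintro h
    simp [h] at h2

lemma exists_of_eventually_ratioFilter {P : ℝ × ℕ × ℕ → Prop}
    (h : ∀ᶠ z in ratioFilter α p, P z) :
    ∃ η > 0, ∀ᶠ t in atTop, ∀ m n : ℕ, |m - α * t| ≤ η * t → |n - p * t| ≤ η * t →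
      P (t, m, n) := by
  rw [ratioFilter, eventually_comap, eventually_prod_iff] at h
  obtain ⟨pa, ha, pb, hb, hab⟩ := h
  rw [← nhds_prod_eq, Metric.nhds_basis_closedBall.eventually_iff] at hb
  obtain ⟨η, hη, hball⟩ := hb
  refine ⟨η, hη, ?_⟩
  filter_upwards [ha, eventually_gt_atTop 0] with t ht ht0 m n hm hn
  refine hab ht (hball (x := (m / t, n / t)) ?_) _ rfl
  have key : ∀ (k : ℕ) (c : ℝ), |k - c * t| ≤ η * t → |(k : ℝ) / t - c| ≤ η := by
    intro k c hk
    rw [show (k : ℝ) / t - c = (k - c * t) / t by field_simp, abs_div, abs_of_pos ht0]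
    exact (div_le_iff₀ ht0).2 hk
  rw [Metric.mem_closedBall, Prod.dist_eq, max_le_iff, Real.dist_eq, Real.dist_eq]
  exact ⟨key m α hm, key n p hn⟩

end ratioFilter

namespace IsCDFOfDensity

variable {f F : ℝ → ℝ}

lemma tendsto_increment (h : IsCDFOfDensity f F) (q c : ℝ) (α p : ℝ) :
    Tendsto (fun w : (ℝ × ℕ × ℕ) × ℝ => w.1.1 * (F (w.2 + c / w.1.1) - F w.2))
      (ratioFilter α p ×ˢ 𝓝 q) (𝓝 (c * f q)) := by
  have hs : HasStrictDerivAt F (f q) q :=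
    hasStrictDerivAt_of_hasDerivAt_of_continuousAt (.of_forall h.hasDerivAt)
      h.continuous_density.continuousAt
  have ht : Tendsto (fun w : (ℝ × ℕ × ℕ) × ℝ => w.1.1) (ratioFilter α p ×ˢ 𝓝 q) atTop :=
    (tendsto_time_ratioFilter α p).comp tendsto_fst
  have hy : Tendsto (fun w : (ℝ × ℕ × ℕ) × ℝ => c / w.1.1) (ratioFilter α p ×ˢ 𝓝 q) (𝓝 0) :=
    ht.const_div_atTop c
  have hu : Tendsto (fun w : (ℝ × ℕ × ℕ) × ℝ => w.2) (ratioFilter α p ×ˢ 𝓝 q) (𝓝 q) :=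
    tendsto_snd
  have hpair : Tendsto (fun w : (ℝ × ℕ × ℕ) × ℝ => (w.2 + c / w.1.1, w.2))
      (ratioFilter α p ×ˢ 𝓝 q) (𝓝 (q, q)) := by
    rw [nhds_prod_eq]
    exact Tendsto.prodMk (by simpa using hu.add hy) hu
  have ho := hs.isLittleO.comp_tendsto hpair
  have hc : Tendsto (fun w : (ℝ × ℕ × ℕ) × ℝ => w.1.1 * (c / w.1.1))
      (ratioFilter α p ×ˢ 𝓝 q) (𝓝 c) := by
    refine tendsto_const_nhds.congr' ?_
    filter_upwards [ht.eventually_gt_atTop 0] with w hw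
    field_simp
  have ho2 := ((Asymptotics.isBigO_refl (fun w : (ℝ × ℕ × ℕ) × ℝ => w.1.1)
    (ratioFilter α p ×ˢ 𝓝 q)).mul_isLittleO ho)
  simp only [Function.comp_def, add_sub_cancel_left,
    ContinuousLinearMap.toSpanSingleton_apply, smul_eq_mul] at ho2
  have := ((Asymptotics.isLittleO_one_iff ℝ).1 (ho2.trans_isBigO (hc.isBigO_one ℝ))).add
    (hc.mul_const (f q))
  rw [zero_add] at this
  exact this.congr fun w => by ring

lemma tendsto_survival_ratio (h : IsCDFOfDensity f F) {α p q : ℝ} (hα : 0 < α)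
    (hq : F q = 1 - α) (c : ℝ) :
    Tendsto (fun w : (ℝ × ℕ × ℕ) × ℝ => ((1 - F (w.2 + c / w.1.1)) / (1 - F w.2)) ^ w.1.2.1)
      (ratioFilter α p ×ˢ 𝓝 q) (𝓝 (Real.exp (-(c * f q)))) := by
  have ht : Tendsto (fun w : (ℝ × ℕ × ℕ) × ℝ => w.1.1) (ratioFilter α p ×ˢ 𝓝 q) atTop :=
    (tendsto_time_ratioFilter α p).comp tendsto_fst
  have hm : Tendsto (fun w : (ℝ × ℕ × ℕ) × ℝ => (w.1.2.1 / w.1.1 : ℝ))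
      (ratioFilter α p ×ˢ 𝓝 q) (𝓝 α) := (tendsto_fst_ratioFilter α p).comp tendsto_fst
  have hF : Tendsto (fun w : (ℝ × ℕ × ℕ) × ℝ => 1 - F w.2) (ratioFilter α p ×ˢ 𝓝 q) (𝓝 α) := by
    have := ((h.continuous.tendsto q).comp
      (tendsto_snd (f := ratioFilter α p) (g := 𝓝 q))).const_sub 1
    rwa [hq, sub_sub_cancel] at this
  have hD : Tendsto (fun w : (ℝ × ℕ × ℕ) × ℝ =>
      -(w.1.1 * (F (w.2 + c / w.1.1) - F w.2)) / (1 - F w.2))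
      (ratioFilter α p ×ˢ 𝓝 q) (𝓝 (-(c * f q) / α)) :=
    (h.tendsto_increment q c α p).neg.div hF hα.ne'
  have hw : Tendsto (fun w : (ℝ × ℕ × ℕ) × ℝ => -(F (w.2 + c / w.1.1) - F w.2) / (1 - F w.2))
      (ratioFilter α p ×ˢ 𝓝 q) (𝓝 0) := by
    refine (hD.div_atTop ht).congr' ?_
    filter_upwards [ht.eventually_gt_atTop 0] with w hw
    field_simp
  have hmw : Tendsto (fun w : (ℝ × ℕ × ℕ) × ℝ =>
      w.1.2.1 * (-(F (w.2 + c / w.1.1) - F w.2) / (1 - F w.2)))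
      (ratioFilter α p ×ˢ 𝓝 q) (𝓝 (-(c * f q))) := by
    have := hm.mul hD
    rw [mul_div_cancel₀ _ hα.ne'] at this
    refine this.congr' ?_
    filter_upwards [ht.eventually_gt_atTop 0] with w hw
    field_simp
  refine (tendsto_one_add_pow_exp_of_tendsto_mul hw hmw).congr' ?_
  filter_upwards [hF.eventually (lt_mem_nhds hα)] with w hw
  congr 1
  field_simp
  ring

lemma tendsto_second_moment {α p : ℝ} (hαp : α + p = 1) :
    Tendsto (fun z : ℝ × ℕ × ℕ =>
      (z.2.2 * (z.2.2 + 1) / ((z.2.2 + z.2.1 + 1) * (z.2.2 + z.2.1 + 2)) -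
        2 * p * (z.2.2 / (z.2.2 + z.2.1 + 1)) + p ^ 2 : ℝ)) (ratioFilter α p) (𝓝 0) := by
  have ht := tendsto_time_ratioFilter α p
  have hm := tendsto_fst_ratioFilter α p
  have hn := tendsto_snd_ratioFilter α p
  have hs : ∀ a : ℝ, Tendsto (fun z : ℝ × ℕ × ℕ => a / z.1) (ratioFilter α p) (𝓝 0) :=
    fun a => ht.const_div_atTop a
  have h1 := (hn.add hm).add (hs 1)
  have h2 := (hn.add hm).add (hs 2)
  have e : p + α + 0 = 1 := by linarith
  rw [e] at h1 h2
  have := (((hn.mul (hn.add (hs 1))).div (h1.mul h2) (by norm_num)).sub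
    ((hn.div h1 one_ne_zero).const_mul (2 * p))).add_const (p ^ 2)
  rw [show p * (p + 0) / (1 * 1) - 2 * p * (p / 1) + p ^ 2 = 0 by ring] at this
  refine this.congr' ?_
  filter_upwards [ht.eventually_gt_atTop 0] with z hz
  simp only [Pi.div_apply]
  field_simp

/-- Away from `q`, where the density is positive, `F` stays away from `F q`. -/
lemma exists_le_abs_sub (h : IsCDFOfDensity f F) {q ρ : ℝ} (hfq : 0 < f q) (hρ : 0 < ρ) :
    ∃ κ > 0, ∀ u, ρ ≤ |u - q| → κ ≤ |F u - F q| := by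
  have hs : ∀ a b : ℝ, a ≤ q → q ≤ b → a < b → F a < F b := by
    intro a b ha hb hab
    rw [← sub_pos, h.sub_eq_intervalIntegral]
    exact intervalIntegral.integral_pos hab h.continuous_density.continuousOn
      (fun x _ => h.nonneg x) ⟨q, ⟨ha, hb⟩, hfq⟩
  have h1 := hs (q - ρ) q (by linarith) le_rfl (by linarith)
  have h2 := hs q (q + ρ) le_rfl (by linarith) (by linarith)
  refine ⟨min (F q - F (q - ρ)) (F (q + ρ) - F q), lt_min (by linarith) (by linarith), ?_⟩
  intro u hu
  rcases le_abs.1 hu with hu | hu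
  · have := h.monotone (show q + ρ ≤ u by linarith)
    exact (min_le_right _ _).trans (le_abs.2 (Or.inl (by linarith)))
  · have := h.monotone (show u ≤ q - ρ by linarith)
    exact (min_le_left _ _).trans (le_abs.2 (Or.inr (by linarith)))

/-- A local estimate near `q` and Chebyshev's inequality away from it control the tail. -/
lemma abs_spacingTail_sub_le (h : IsCDFOfDensity f F) {q y ε e ρ κ : ℝ} {m n : ℕ} (hn : 1 ≤ n)
    (hy : 0 ≤ y) (hε : 0 ≤ ε) (he0 : 0 ≤ e) (he1 : e ≤ 1) (hκ : 0 < κ)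
    (hκρ : ∀ u, ρ ≤ |u - q| → κ ≤ |F u - F q|)
    (hloc : ∀ u, |u - q| < ρ → 0 < 1 - F u ∧ |((1 - F (u + y)) / (1 - F u)) ^ m - e| ≤ ε) :
    |spacingTail f F m n y - e| ≤
      ε + (1 / κ ^ 2) * ∫ u, orderDensity f F m n u * (F u - F q) ^ 2 := by
  set C : ℝ := ((n + m).factorial : ℝ) / ((n - 1).factorial * m.factorial) with hC
  have hC0 : 0 ≤ C := by positivity
  have hb : Integrable (orderDensity f F m n) := by
    simpa using h.integrable_orderDensity_mul_pow m n 0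
  have hs := (h.integrable_shift (n - 1) m y).const_mul C
  have hv : Integrable fun u => orderDensity f F m n u * (F u - F q) ^ 2 := by
    have := h.continuous
    refine hb.mul_bdd (c := 1) (by fun_prop) (ae_of_all _ fun u => ?_)
    rw [Real.norm_of_nonneg (sq_nonneg _), sq_le_one_iff_abs_le_one, abs_le]
    have := h.cdf_nonneg u
    have := h.cdf_le_one u
    have := h.cdf_nonneg q
    have := h.cdf_le_one q
    constructor <;> linarith
  have e1 : spacingTail f F m n y - e =
      ∫ u, (C * (f u * (F u ^ (n - 1) * (1 - F (u + y)) ^ m)) - e * orderDensity f F m n u) := by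
    rw [integral_sub hs (hb.const_mul e), integral_const_mul, integral_const_mul,
      h.integral_orderDensity m n hn, spacingTail, mul_one]
  have e2 : ε + (1 / κ ^ 2) * ∫ u, orderDensity f F m n u * (F u - F q) ^ 2 =
      ∫ u, (ε * orderDensity f F m n u +
        (1 / κ ^ 2) * (orderDensity f F m n u * (F u - F q) ^ 2)) := by
    rw [integral_add (hb.const_mul ε) (hv.const_mul _), integral_const_mul, integral_const_mul,
      h.integral_orderDensity m n hn, mul_one]
  rw [e1, e2]
  refine (abs_integral_le_integral_abs).trans (integral_mono (hs.sub (hb.const_mul e)).abs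
    ((hb.const_mul ε).add (hv.const_mul _)) fun u => ?_)
  have hw : 0 ≤ C * (f u * F u ^ (n - 1)) :=
    mul_nonneg hC0 (mul_nonneg (h.nonneg u) (pow_nonneg (h.cdf_nonneg u) _))
  have hod : orderDensity f F m n u = C * (f u * F u ^ (n - 1)) * (1 - F u) ^ m := by
    rw [orderDensity]
    ring
  have hod0 := h.orderDensity_nonneg m n u
  have e3 : C * (f u * (F u ^ (n - 1) * (1 - F (u + y)) ^ m)) - e * orderDensity f F m n u =
      C * (f u * F u ^ (n - 1)) * ((1 - F (u + y)) ^ m - e * (1 - F u) ^ m) := by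
    rw [hod]
    ring
  simp only [e3]
  rw [abs_mul, abs_of_nonneg hw]
  by_cases hu : |u - q| < ρ
  · obtain ⟨hpos, hr⟩ := hloc u hu
    have e4 : (1 - F (u + y)) ^ m - e * (1 - F u) ^ m =
        (((1 - F (u + y)) / (1 - F u)) ^ m - e) * (1 - F u) ^ m := by
      rw [div_pow]
      field_simp
    rw [e4, abs_mul, abs_of_pos (pow_pos hpos m)]
    calc _ ≤ C * (f u * F u ^ (n - 1)) * (ε * (1 - F u) ^ m) := by gcongr
      _ = ε * orderDensity f F m n u := by rw [hod]; ring
      _ ≤ _ := le_add_of_nonneg_right (by positivity)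
  · have hk := hκρ u (not_lt.1 hu)
    have h1 : 1 ≤ (1 / κ ^ 2) * (F u - F q) ^ 2 := by
      rw [one_div_mul_eq_div, one_le_div (by positivity), ← sq_abs (F u - F q)]
      gcongr
    have h2 : |(1 - F (u + y)) ^ m - e * (1 - F u) ^ m| ≤ (1 - F u) ^ m := by
      have hm1 := h.monotone (show u ≤ u + y by linarith)
      have a1 := pow_nonneg (h.one_sub_nonneg (u + y)) m
      have a2 := pow_nonneg (h.one_sub_nonneg u) m
      have a3 : (1 - F (u + y)) ^ m ≤ (1 - F u) ^ m :=
        pow_le_pow_left₀ (h.one_sub_nonneg _) (by linarith) m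
      rw [abs_le]
      constructor <;> nlinarith
    calc _ ≤ C * (f u * F u ^ (n - 1)) * (1 - F u) ^ m := by gcongr
      _ = orderDensity f F m n u * 1 := by rw [hod, mul_one]
      _ ≤ orderDensity f F m n u * ((1 / κ ^ 2) * (F u - F q) ^ 2) := by gcongr
      _ = (1 / κ ^ 2) * (orderDensity f F m n u * (F u - F q) ^ 2) := by ring
      _ ≤ _ := le_add_of_nonneg_left (by positivity)

lemma tendsto_spacingTail (h : IsCDFOfDensity f F) {α q c : ℝ} (hα : α ∈ Set.Ioo (0 : ℝ) 1)
    (hq : F q = 1 - α) (hfq : 0 < f q) (hc : 0 ≤ c) :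
    Tendsto (fun z : ℝ × ℕ × ℕ => spacingTail f F z.2.1 z.2.2 (c / z.1))
      (ratioFilter α (1 - α)) (𝓝 (Real.exp (-(c * f q)))) := by
  rw [Metric.tendsto_nhds]
  intro ε hε
  have h1 := (Metric.tendsto_nhds.1
    (h.tendsto_survival_ratio (p := 1 - α) hα.1 hq c)) (ε / 2) (by positivity)
  have hF : ∀ᶠ w in ratioFilter α (1 - α) ×ˢ 𝓝 q, 0 < 1 - F w.2 := by
    have h0 : Tendsto (fun u => 1 - F u) (𝓝 q) (𝓝 α) := by
      simpa [hq] using (h.continuous.tendsto q).const_sub 1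
    exact tendsto_snd.eventually (h0.eventually (lt_mem_nhds hα.1))
  obtain ⟨pa, ha, pb, hb, hab⟩ := eventually_prod_iff.1 (hF.and h1)
  obtain ⟨ρ, hρ, hball⟩ := Metric.eventually_nhds_iff.1 hb
  obtain ⟨κ, hκ, hκρ⟩ := h.exists_le_abs_sub hfq hρ
  have h2 := (tendsto_second_moment (show α + (1 - α) = 1 by ring)).const_mul (1 / κ ^ 2)
  rw [mul_zero] at h2
  filter_upwards [ha, h2.eventually (gt_mem_nhds (show 0 < ε / 2 by positivity)),
    eventually_one_le_ratioFilter hα.1 (sub_pos.2 hα.2),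
    (tendsto_time_ratioFilter α (1 - α)).eventually_gt_atTop 0] with z hz hz2 hmn ht
  have key := h.abs_spacingTail_sub_le (q := q) (y := c / z.1) (ε := ε / 2)
    (e := Real.exp (-(c * f q))) (ρ := ρ) (m := z.2.1) hmn.2 (by positivity) (by positivity)
    (Real.exp_pos _).le (Real.exp_le_one_iff.2 (neg_nonpos.2 (by positivity))) hκ hκρ
    (fun u hu => ⟨(hab hz (hball hu)).1, (hab hz (hball hu)).2.le⟩)
  rw [hq, h.integral_orderDensity_mul_sq _ _ hmn.2] at key
  rw [Real.dist_eq]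
  linarith

end IsCDFOfDensity

/-- The Poisson probability mass function with parameter `r`. -/
noncomputable def poissonWeight (r : ℝ) (m : ℕ) : ℝ := Real.exp (-r) * r ^ m / m.factorial

lemma poissonWeight_nonneg {r : ℝ} (hr : 0 ≤ r) (m : ℕ) : 0 ≤ poissonWeight r m := by
  unfold poissonWeight
  positivity

lemma hasSum_poissonWeight {r : ℝ} (hr : 0 ≤ r) : HasSum (poissonWeight r) 1 :=
  hasSum_one_poissonMeasure ⟨r, hr⟩

lemma HasSum.poissonWeight_mul_shift {r s : ℝ} {g : ℕ → ℝ}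
    (hg : HasSum (fun m => poissonWeight r m * g m) s) :
    HasSum (fun m => poissonWeight r m * (m * g (m - 1))) (r * s) := by
  rw [← hasSum_nat_add_iff' 1]
  simp only [Finset.range_one, Finset.sum_singleton, Nat.cast_zero, zero_mul, mul_zero, sub_zero]
  convert! hg.mul_left r using 2 with m
  simp only [poissonWeight, Nat.factorial_succ, add_tsub_cancel_right]
  push_cast
  field_simp
  ring

lemma hasSum_poissonWeight_mul_sq {r : ℝ} (hr : 0 ≤ r) :
    HasSum (fun m => poissonWeight r m * (m - r) ^ 2) r := by
  have h0 : HasSum (fun m => poissonWeight r m * 1) 1 := by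
    simpa using hasSum_poissonWeight hr
  have h1 := h0.poissonWeight_mul_shift
  simp only [mul_one] at h1
  have h2 := h1.poissonWeight_mul_shift
  have h3 := ((h2.add h1).sub (h1.mul_left (2 * r))).add (h0.mul_left (r ^ 2))
  rw [show r * r + r - 2 * r * r + r ^ 2 * 1 = r by ring] at h3
  convert! h3 using 2 with m
  cases m with
  | zero => simp; ring
  | succ m => simp; ring

lemma tendsto_tsum_poissonWeight {α p : ℝ} (hα : 0 ≤ α) (hp : 0 ≤ p) {G : ℝ → ℕ → ℕ → ℝ} {c : ℝ}
    (hG : ∀ t m n, G t m n ∈ Set.Icc (0 : ℝ) 1) (hc : c ∈ Set.Icc (0 : ℝ) 1)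
    (hlim : Tendsto (fun z : ℝ × ℕ × ℕ => G z.1 z.2.1 z.2.2) (ratioFilter α p) (𝓝 c)) :
    Tendsto (fun t => ∑' k : ℕ × ℕ, poissonWeight (α * t) k.1 * poissonWeight (p * t) k.2 *
      G t k.1 k.2) atTop (𝓝 c) := by
  rw [Metric.tendsto_nhds]
  intro ε hε
  obtain ⟨η, hη, hev⟩ := exists_of_eventually_ratioFilter
    (Metric.tendsto_nhds.1 hlim (ε / 2) (by positivity))
  have hsmall : Tendsto (fun t : ℝ => (α + p) / η ^ 2 / t) atTop (𝓝 0) :=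
    tendsto_id.const_div_atTop _
  filter_upwards [hev, eventually_gt_atTop 0,
    hsmall.eventually (gt_mem_nhds (show 0 < ε / 2 by positivity))] with t ht ht0 hts
  have ha : 0 ≤ α * t := by positivity
  have hb : 0 ≤ p * t := by positivity
  have prod : ∀ {g₁ g₂ : ℕ → ℝ} {s₁ s₂ : ℝ}, (∀ m, 0 ≤ g₁ m) → (∀ m, 0 ≤ g₂ m) →
      HasSum g₁ s₁ → HasSum g₂ s₂ → HasSum (fun k : ℕ × ℕ => g₁ k.1 * g₂ k.2) (s₁ * s₂) :=
    fun h1 h2 h3 h4 => h3.mul h4 (h3.summable.mul_of_nonneg h4.summable h1 h2)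
  set w : ℕ × ℕ → ℝ := fun k => poissonWeight (α * t) k.1 * poissonWeight (p * t) k.2 with hw
  have hw0 : ∀ k, 0 ≤ w k := fun k =>
    mul_nonneg (poissonWeight_nonneg ha _) (poissonWeight_nonneg hb _)
  have s0 : HasSum w (1 * 1) := prod (poissonWeight_nonneg ha) (poissonWeight_nonneg hb)
    (hasSum_poissonWeight ha) (hasSum_poissonWeight hb)
  have s1 := prod (fun m => mul_nonneg (poissonWeight_nonneg ha m) (sq_nonneg _))
    (poissonWeight_nonneg hb) (hasSum_poissonWeight_mul_sq ha) (hasSum_poissonWeight hb)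
  have s2 := prod (poissonWeight_nonneg ha)
    (fun m => mul_nonneg (poissonWeight_nonneg hb m) (sq_nonneg _))
    (hasSum_poissonWeight ha) (hasSum_poissonWeight_mul_sq hb)
  have sB := (s0.mul_left (ε / 2)).add ((s1.add s2).mul_left (1 / (η * t) ^ 2))
  have sG : Summable fun k => w k * G t k.1 k.2 :=
    s0.summable.of_nonneg_of_le (fun k => mul_nonneg (hw0 k) (hG t k.1 k.2).1)
      fun k => mul_le_of_le_one_right (hw0 k) (hG t k.1 k.2).2
  have sD := sG.hasSum.sub (s0.mul_right c)
  have hbound : ∀ k : ℕ × ℕ, ‖w k * G t k.1 k.2 - w k * c‖ ≤ ε / 2 * w k +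
      1 / (η * t) ^ 2 * (poissonWeight (α * t) k.1 * (k.1 - α * t) ^ 2 * poissonWeight (p * t) k.2 +
        poissonWeight (α * t) k.1 * (poissonWeight (p * t) k.2 * (k.2 - p * t) ^ 2)) := by
    intro k
    have e : ε / 2 * w k +
      1 / (η * t) ^ 2 * (poissonWeight (α * t) k.1 * (k.1 - α * t) ^ 2 * poissonWeight (p * t) k.2 +
        poissonWeight (α * t) k.1 * (poissonWeight (p * t) k.2 * (k.2 - p * t) ^ 2)) =
        w k * (ε / 2 + (k.1 - α * t) ^ 2 / (η * t) ^ 2 + (k.2 - p * t) ^ 2 / (η * t) ^ 2) := by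
      simp only [hw]
      ring
    rw [e, ← mul_sub, norm_mul, Real.norm_of_nonneg (hw0 k)]
    refine mul_le_mul_of_nonneg_left ?_ (hw0 k)
    have hfar : ∀ a : ℝ, ¬ |a| ≤ η * t → 1 ≤ a ^ 2 / (η * t) ^ 2 := by
      intro a h
      have : 0 < η * t := by positivity
      rw [one_le_div (by positivity), ← sq_abs a]
      exact pow_le_pow_left₀ this.le (not_le.1 h).le 2
    have hone : ‖G t k.1 k.2 - c‖ ≤ 1 := by
      have := hG t k.1 k.2
      rw [Real.norm_eq_abs, abs_le]
      constructor <;> linarith [this.1, this.2, hc.1, hc.2]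
    have p1 : 0 ≤ (k.1 - α * t) ^ 2 / (η * t) ^ 2 := by positivity
    have p2 : 0 ≤ (k.2 - p * t) ^ 2 / (η * t) ^ 2 := by positivity
    by_cases h1 : |k.1 - α * t| ≤ η * t
    · by_cases h2 : |k.2 - p * t| ≤ η * t
      · have := ht k.1 k.2 h1 h2
        rw [dist_eq_norm] at this
        linarith
      · linarith [hfar _ h2]
    · linarith [hfar _ h1]
  have key := tsum_of_norm_bounded sB hbound
  rw [sD.tsum_eq] at key
  simp only [mul_one, one_mul] at key
  rw [dist_eq_norm]
  have e : 1 / (η * t) ^ 2 * (α * t + p * t) = (α + p) / η ^ 2 / t := by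
    field_simp
  rw [e] at key
  linarith

section Partition

variable {Ω ι : Type*} [MeasurableSpace Ω] {μ : Measure Ω} [IsProbabilityMeasure μ]

lemma nullMeasurableSet_of_measure_add_compl_le {A : Set Ω} (h : μ A + μ Aᶜ ≤ 1) :
    NullMeasurableSet A μ := by
  have hB := measurableSet_toMeasurable μ Aᶜ
  have hsub : (toMeasurable μ Aᶜ)ᶜ ⊆ A := Set.compl_subset_comm.1 (subset_toMeasurable μ Aᶜ)
  have hμ : μ A ≤ μ (toMeasurable μ Aᶜ)ᶜ := by
    rw [prob_compl_eq_one_sub hB, measure_toMeasurable]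
    exact ENNReal.le_sub_of_add_le_right (measure_ne_top _ _) h
  exact ⟨_, hB.compl, (ae_eq_of_subset_of_measure_ge hsub hμ hB.compl.nullMeasurableSet
    (measure_ne_top _ _)).symm⟩

/-- Along a countable partition whose outer measures sum to one, outer measure is additive. -/
lemma measure_eq_tsum_inter_of_tsum_eq_one [Countable ι] {A : ι → Set Ω}
    (hd : Pairwise (Function.onFun Disjoint A)) (hU : ⋃ i, A i = Set.univ)
    (h1 : ∑' i, μ (A i) = 1) (E : Set Ω) : μ E = ∑' i, μ (E ∩ A i) := by
  classical
  have hm : ∀ i, NullMeasurableSet (A i) μ := by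
    intro i
    refine nullMeasurableSet_of_measure_add_compl_le (μ := μ) ?_
    have hc : (A i)ᶜ ⊆ ⋃ j, if j = i then ∅ else A j := by
      intro ω hω
      obtain ⟨j, hj⟩ := Set.mem_iUnion.1 (hU ▸ Set.mem_univ ω)
      refine Set.mem_iUnion.2 ⟨j, ?_⟩
      rw [if_neg (fun hji : j = i => hω (hji ▸ hj))]
      exact hj
    calc μ (A i) + μ (A i)ᶜ
        ≤ μ (A i) + ∑' j, if j = i then 0 else μ (A j) := by
          gcongr
          refine (measure_mono hc).trans ((measure_iUnion_le _).trans_eq (tsum_congr fun j => ?_))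
          split_ifs <;> simp
      _ = ∑' j, μ (A j) := by
          rw [ENNReal.tsum_eq_add_tsum_ite (f := fun j => μ (A j)) i]
      _ ≤ 1 := h1.le
  refine le_antisymm ?_ ?_
  · calc μ E = μ (⋃ i, E ∩ A i) := by rw [← Set.inter_iUnion, hU, Set.inter_univ]
      _ ≤ _ := measure_iUnion_le _
  · calc ∑' i, μ (E ∩ A i) ≤ ∑' i, μ (toMeasurable μ E ∩ A i) :=
          ENNReal.tsum_le_tsum fun i =>
            measure_mono (Set.inter_subset_inter_left _ (subset_toMeasurable μ E))
      _ = μ (⋃ i, toMeasurable μ E ∩ A i) :=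
          (measure_iUnion₀ (fun i j hij => ((hd hij).mono Set.inter_subset_right
            Set.inter_subset_right).aedisjoint)
            fun i => (measurableSet_toMeasurable μ E).nullMeasurableSet.inter (hm i)).symm
      _ = μ E := by rw [← Set.inter_iUnion, hU, Set.inter_univ, measure_toMeasurable]

/-- Law of total probability for an event described through two Poisson counts. -/
lemma toReal_measure_eq_tsum_poissonWeight {a b : ℝ} (ha : 0 ≤ a) (hb : 0 ≤ b) {M N : Ω → ℕ}
    (hM : ∀ m, μ {ω | M ω = m} = ENNReal.ofReal (poissonWeight a m))
    (hN : ∀ n, μ {ω | N ω = n} = ENNReal.ofReal (poissonWeight b n))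
    (hindep : ∀ m n, μ {ω | M ω = m ∧ N ω = n} = μ {ω | M ω = m} * μ {ω | N ω = n})
    {E : Set Ω} {g : ℕ → ℕ → ℝ} (hg : ∀ m n, 0 ≤ g m n)
    (hE : ∀ m n, μ (E ∩ {ω | M ω = m ∧ N ω = n}) =
      μ {ω | M ω = m ∧ N ω = n} * ENNReal.ofReal (g m n)) :
    (μ E).toReal = ∑' k : ℕ × ℕ, poissonWeight a k.1 * poissonWeight b k.2 * g k.1 k.2 := by
  have hsum : ∀ {r : ℝ}, 0 ≤ r → ∑' m, ENNReal.ofReal (poissonWeight r m) = 1 := by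
    intro r hr
    rw [← ENNReal.ofReal_tsum_of_nonneg (poissonWeight_nonneg hr)
      (hasSum_poissonWeight hr).summable, (hasSum_poissonWeight hr).tsum_eq, ENNReal.ofReal_one]
  have h1 : ∑' k : ℕ × ℕ, μ {ω | M ω = k.1 ∧ N ω = k.2} = 1 := by
    simp only [hindep, hM, hN]
    rw [ENNReal.tsum_prod (f := fun m n =>
      ENNReal.ofReal (poissonWeight a m) * ENNReal.ofReal (poissonWeight b n))]
    simp only [ENNReal.tsum_mul_left, hsum hb, mul_one, hsum ha]
  have hd : Pairwise (Function.onFun Disjoint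
      fun k : ℕ × ℕ => {ω | M ω = k.1 ∧ N ω = k.2}) := by
    intro i j hij
    refine Set.disjoint_left.2 fun ω hi hj => hij (Prod.ext ?_ ?_)
    · exact hi.1.symm.trans hj.1
    · exact hi.2.symm.trans hj.2
  have hU : ⋃ k : ℕ × ℕ, {ω | M ω = k.1 ∧ N ω = k.2} = Set.univ :=
    Set.eq_univ_of_forall fun ω => Set.mem_iUnion.2 ⟨(M ω, N ω), rfl, rfl⟩
  rw [measure_eq_tsum_inter_of_tsum_eq_one hd hU h1 E,
    ENNReal.tsum_toReal_eq fun k => measure_ne_top _ _]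
  refine tsum_congr fun k => ?_
  rw [hE, hindep, hM, hN, ENNReal.toReal_mul, ENNReal.toReal_mul,
    ENNReal.toReal_ofReal (poissonWeight_nonneg ha _),
    ENNReal.toReal_ofReal (poissonWeight_nonneg hb _), ENNReal.toReal_ofReal (hg _ _)]

end Partition

/-- Fix `α ∈ (0,1)` and an absolutely continuous distribution `F` with
continuous density `f`, strictly positive at `q = F⁻¹(1−α)`.  For each `t > 0`, let `M_t`,
`N_t` be independent Poisson random variables with parameters `αt` and `(1−α)t`, and
conditionally on `M_t = m ≥ 1`, `N_t = n ≥ 1`, let `R_t` be distributed as the spacing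
`Z_(n+1) − Z_(n)` of an i.i.d. `(n+m)`-sample from `F` (whose density for `δ > 0` is
`δ ↦ (n+m)!/((n−1)!(m−1)!) ∫ F(x)^{n−1} f(x) f(x+δ)(1−F(x+δ))^{m−1} dx`).  Then, as
`t → ∞`, the conditional law of `t f(q) R_t` given `{M_t ≥ 1, N_t ≥ 1}` converges weakly to
the exponential distribution with parameter `1` (expressed via pointwise convergence of the
conditional distribution functions). -/
theorem stmt_15 {Ω : Type*} [MeasurableSpace Ω] (μ : Measure Ω) [IsProbabilityMeasure μ]
    (α : ℝ) (hα : α ∈ Set.Ioo (0 : ℝ) 1)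
    (f : ℝ → ℝ) (hf0 : ∀ x, 0 ≤ f x) (hf1 : ∫ x, f x = 1) (hfcont : Continuous f)
    (F : ℝ → ℝ) (hF : ∀ x, F x = ∫ u in Set.Iic x, f u)
    (q : ℝ) (hq : F q = 1 - α) (hfq : 0 < f q)
    (M N : ℝ → Ω → ℕ) (R : ℝ → Ω → ℝ)
    (hM : ∀ t : ℝ, 0 < t → ∀ m : ℕ,
      μ {ω | M t ω = m}
        = ENNReal.ofReal (Real.exp (-(α * t)) * (α * t) ^ m / (m.factorial : ℝ)))
    (hN : ∀ t : ℝ, 0 < t → ∀ n : ℕ,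
      μ {ω | N t ω = n}
        = ENNReal.ofReal (Real.exp (-((1 - α) * t)) * ((1 - α) * t) ^ n / (n.factorial : ℝ)))
    (hindep : ∀ t : ℝ, 0 < t → ∀ m n : ℕ,
      μ {ω | M t ω = m ∧ N t ω = n} = μ {ω | M t ω = m} * μ {ω | N t ω = n})
    (hR : ∀ t : ℝ, 0 < t → ∀ m n : ℕ, 1 ≤ m → 1 ≤ n → ∀ x : ℝ,
      μ {ω | R t ω ≤ x ∧ M t ω = m ∧ N t ω = n}
        = μ {ω | M t ω = m ∧ N t ω = n} *
            ENNReal.ofReal (∫ δ in Set.Iic x,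
              (Set.Ioi (0 : ℝ)).indicator
                (fun δ =>
                  (((n + m).factorial : ℝ) /
                      (((n - 1).factorial : ℝ) * ((m - 1).factorial : ℝ))) *
                    ∫ u : ℝ, F u ^ (n - 1) * f u * f (u + δ) * (1 - F (u + δ)) ^ (m - 1)) δ)) :
    ∀ x : ℝ,
      Tendsto (fun t : ℝ =>
          (μ {ω | t * f q * R t ω ≤ x ∧ 1 ≤ M t ω ∧ 1 ≤ N t ω}).toReal /
            (μ {ω | 1 ≤ M t ω ∧ 1 ≤ N t ω}).toReal)
        atTop (𝓝 ((expMeasure 1 (Set.Iic x)).toReal)) := by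
  have h : IsCDFOfDensity f F := ⟨hf0, hf1, hfcont, hF⟩
  have hp : 0 < 1 - α := sub_pos.2 hα.2
  intro x
  let G : ℝ → ℕ → ℕ → ℝ := fun t m n =>
    if 1 ≤ m ∧ 1 ≤ n then spacingCDF f F m n (x / f q / t) else 0
  let J : ℝ → ℕ → ℕ → ℝ := fun _ m n => if 1 ≤ m ∧ 1 ≤ n then 1 else 0
  have hG : ∀ t m n, G t m n ∈ Set.Icc (0 : ℝ) 1 := by
    intro t m n
    simp only [G]
    split_ifs with hmn
    · exact h.spacingCDF_mem m n hmn.1 hmn.2 _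
    · simp
  have hJ : ∀ t m n, J t m n ∈ Set.Icc (0 : ℝ) 1 := by
    intro t m n
    simp only [J]
    split_ifs <;> simp
  have hmn := eventually_one_le_ratioFilter hα.1 hp
  have hcdf : (expMeasure 1 (Set.Iic x)).toReal = if 0 ≤ x then 1 - Real.exp (-x) else 0 := by
    have := isProbabilityMeasure_expMeasure one_pos
    have e := cdf_expMeasure_eq one_pos x
    rw [cdf_eq_real, one_mul] at e
    exact e
  have hcmem : (expMeasure 1 (Set.Iic x)).toReal ∈ Set.Icc (0 : ℝ) 1 := by
    have := isProbabilityMeasure_expMeasure one_pos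
    exact ⟨ENNReal.toReal_nonneg, measureReal_le_one⟩
  have hGlim : Tendsto (fun z : ℝ × ℕ × ℕ => G z.1 z.2.1 z.2.2) (ratioFilter α (1 - α))
      (𝓝 (expMeasure 1 (Set.Iic x)).toReal) := by
    have ht := (tendsto_time_ratioFilter α (1 - α)).eventually_gt_atTop 0
    rw [hcdf]
    split_ifs with hx
    · have hx' : 0 ≤ x / f q := by positivity
      have key := (h.tendsto_spacingTail hα hq hfq hx').const_sub 1
      rw [div_mul_cancel₀ _ hfq.ne'] at key
      refine key.congr' ?_
      filter_upwards [hmn, ht] with z hz htz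
      simp only [G]
      rw [if_pos hz, h.spacingCDF_eq _ _ hz.1 hz.2 (by positivity)]
    · refine tendsto_const_nhds.congr' ?_
      filter_upwards [hmn, ht] with z hz htz
      simp only [G]
      rw [if_pos hz, spacingCDF_of_nonpos]
      exact div_nonpos_of_nonpos_of_nonneg
        (div_nonpos_of_nonpos_of_nonneg (not_le.1 hx).le hfq.le) htz.le
  have hJlim : Tendsto (fun z : ℝ × ℕ × ℕ => J z.1 z.2.1 z.2.2) (ratioFilter α (1 - α))
      (𝓝 1) := by
    refine tendsto_const_nhds.congr' ?_
    filter_upwards [hmn] with z hz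
    simp only [J]
    rw [if_pos hz]
  have hnum := tendsto_tsum_poissonWeight hα.1.le hp.le hG hcmem hGlim
  have hden := tendsto_tsum_poissonWeight hα.1.le hp.le hJ (by simp) hJlim
  have hlim := hnum.div hden one_ne_zero
  rw [div_one] at hlim
  refine hlim.congr' ?_
  filter_upwards [eventually_gt_atTop 0] with t ht
  have ha : 0 ≤ α * t := mul_nonneg hα.1.le ht.le
  have hb : 0 ≤ (1 - α) * t := mul_nonneg hp.le ht.le
  rw [Pi.div_apply]
  congr 1
  · refine (toReal_measure_eq_tsum_poissonWeight ha hb (hM t ht) (hN t ht) (hindep t ht)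
      (fun m n => (hG t m n).1) fun m n => ?_).symm
    simp only [G]
    split_ifs with hmn
    · rw [spacingCDF, ← hR t ht m n hmn.1 hmn.2]
      congr 1
      ext ω
      have e : t * f q * R t ω ≤ x ↔ R t ω ≤ x / f q / t := by
        rw [le_div_iff₀ ht, le_div_iff₀ hfq]
        ring_nf
      simp only [Set.mem_inter_iff, Set.mem_ofPred_eq, e]
      constructor
      · rintro ⟨⟨h1, -, -⟩, h2⟩
        exact ⟨h1, h2⟩
      · rintro ⟨h1, h2, h3⟩
        exact ⟨⟨h1, h2 ▸ hmn.1, h3 ▸ hmn.2⟩, h2, h3⟩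
    · rw [ENNReal.ofReal_zero, mul_zero]
      convert measure_empty (μ := μ)
      refine Set.eq_empty_of_forall_notMem ?_
      rintro ω ⟨⟨-, h1, h2⟩, h3, h4⟩
      exact hmn ⟨h3 ▸ h1, h4 ▸ h2⟩
  · refine (toReal_measure_eq_tsum_poissonWeight ha hb (hM t ht) (hN t ht) (hindep t ht)
      (fun m n => (hJ t m n).1) fun m n => ?_).symm
    simp only [J]
    split_ifs with hmn
    · rw [ENNReal.ofReal_one, mul_one]
      congr 1
      refine Set.inter_eq_right.2 ?_
      rintro ω ⟨h2, h3⟩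
      exact ⟨h2 ▸ hmn.1, h3 ▸ hmn.2⟩
    · rw [ENNReal.ofReal_zero, mul_zero]
      convert measure_empty (μ := μ)
      refine Set.eq_empty_of_forall_notMem ?_
      rintro ω ⟨⟨h1, h2⟩, h3, h4⟩
      exact hmn ⟨h3 ▸ h1, h4 ▸ h2⟩
end

section
/- Fix α ∈ (0,1), θ > 0 and T > 0, and set μ_λ = (λ/θ)(1 − e^{−θT}) for λ > 0. For each λ, let M_λ and N_λ be independent Poisson random variables with parameters α μ_λ and (1−α) μ_λ, and let V_λ have conditional hypergeometric law P(V_λ = k | M_λ = m, N_λ = n) = C(m,k)C(n,k)/C(m+n,n). Then, as λ → ∞, (V_λ − μ_λ α(1−α)) / sqrt(μ_λ α(1−α)(1 − 2α(1−α))) converges in distribution to the standard normal law N(0,1); i.e., the traded volume of the call auction with cancellation rate θ is asymptotically normal with mean (λ/θ)(1 − e^{−θT}) α(1−α) and standard deviation sqrt((λ/θ)(1 − e^{−θT}) α(1−α)(1 − 2α(1−α))). -/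
open MeasureTheory ProbabilityTheory Filter Topology

/-- A map into a countable space whose fibres have outer measures summing to the total mass is
almost everywhere measurable. -/
lemma aemeasurable_of_tsum_measure_fiber_le {Ω ι : Type*} [MeasurableSpace Ω] (μ : Measure Ω)
    [IsProbabilityMeasure μ] [Countable ι] [MeasurableSpace ι] [DiscreteMeasurableSpace ι]
    (Y : Ω → ι) (h : ∑' i, μ (Y ⁻¹' {i}) ≤ 1) : AEMeasurable Y μ := by
  refine NullMeasurable.aemeasurable fun s _ ↦ ?_
  have hle (s : Set ι) : μ (Y ⁻¹' s) ≤ ∑' i, s.indicator (fun i ↦ μ (Y ⁻¹' {i})) i := by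
    have hs : Y ⁻¹' s = ⋃ i : s, Y ⁻¹' {(i : ι)} := by ext; simp
    rw [hs, ← tsum_subtype]
    exact measure_iUnion_le _
  have hsum : μ (Y ⁻¹' s) + μ (Y ⁻¹' s)ᶜ ≤ 1 := by
    refine (add_le_add (hle s) (hle sᶜ)).trans ?_
    rw [← ENNReal.tsum_add]
    simpa only [Set.indicator_self_add_compl_apply] using h
  set A := Y ⁻¹' s
  have hunion : toMeasurable μ A ∪ toMeasurable μ Aᶜ = Set.univ :=
    Set.univ_subset_iff.1 <| (Set.union_compl_self A).symm.subset.trans <|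
      Set.union_subset_union (subset_toMeasurable μ A) (subset_toMeasurable μ Aᶜ)
  have hinter : μ (toMeasurable μ A ∩ toMeasurable μ Aᶜ) = 0 := by
    have key := measure_union_add_inter (μ := μ) (toMeasurable μ A)
      (measurableSet_toMeasurable μ Aᶜ)
    rw [hunion, measure_univ, measure_toMeasurable, measure_toMeasurable] at key
    have : (1 : ENNReal) + μ (toMeasurable μ A ∩ toMeasurable μ Aᶜ) ≤ 1 + 0 := by
      rw [key, add_zero]; exact hsum
    exact le_zero_iff.1 ((ENNReal.add_le_add_iff_left ENNReal.one_ne_top).1 this)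
  refine (measurableSet_toMeasurable μ A).nullMeasurableSet.congr ?_
  refine (ae_le_set.2 (measure_mono_null ?_ hinter)).antisymm
    (subset_toMeasurable μ A).eventuallyLE
  exact fun ω hω ↦ ⟨hω.1, subset_toMeasurable μ Aᶜ hω.2⟩

/-- The generating polynomial of the overlap counts `C(m,k) C(n,k)`. -/
noncomputable def overlapPoly (z : ℂ) (m n : ℕ) : ℂ :=
  ∑ k ∈ Finset.range (n + 1), (m.choose k : ℂ) * n.choose k * z ^ k

lemma overlapPoly_eq_sum_range (z : ℂ) (m : ℕ) {n K : ℕ} (h : n + 1 ≤ K) :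
    overlapPoly z m n = ∑ k ∈ Finset.range K, (m.choose k : ℂ) * n.choose k * z ^ k := by
  refine Finset.sum_subset (Finset.range_mono h) fun k _ hk ↦ ?_
  rw [Nat.choose_eq_zero_of_lt (by simpa using hk : n < k)]
  simp

lemma overlapPoly_zero_left (z : ℂ) (n : ℕ) : overlapPoly z 0 n = 1 := by
  simp [overlapPoly, Finset.sum_range_succ']

lemma overlapPoly_zero_right (z : ℂ) (m : ℕ) : overlapPoly z m 0 = 1 := by
  simp [overlapPoly]

lemma overlapPoly_succ_succ (z : ℂ) (m n : ℕ) :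
    overlapPoly z (m + 1) (n + 1) =
      overlapPoly z m (n + 1) + overlapPoly z (m + 1) n - (1 - z) * overlapPoly z m n := by
  have h : z * overlapPoly z m n =
      ∑ k ∈ Finset.range (n + 1), (m.choose k : ℂ) * n.choose k * z ^ (k + 1) := by
    rw [overlapPoly, Finset.mul_sum]
    exact Finset.sum_congr rfl fun k _ ↦ by ring
  rw [sub_mul, one_mul, h, overlapPoly_eq_sum_range z (m + 1) (le_refl (n + 2)),
    overlapPoly_eq_sum_range z m (le_refl (n + 2)),
    overlapPoly_eq_sum_range z (m + 1) (Nat.le_succ (n + 1)),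
    overlapPoly_eq_sum_range z m (Nat.le_succ (n + 1))]
  simp only [Finset.sum_range_succ' _ (n + 1), Nat.choose_zero_right, Nat.choose_succ_succ]
  have : ∑ k ∈ Finset.range (n + 1), ((m.choose k + m.choose (k + 1) : ℕ) : ℂ) *
        (n.choose k + n.choose (k + 1) : ℕ) * z ^ (k + 1) =
      ∑ k ∈ Finset.range (n + 1), (m.choose (k + 1) : ℂ) *
        (n.choose k + n.choose (k + 1) : ℕ) * z ^ (k + 1) +
      ∑ k ∈ Finset.range (n + 1), ((m.choose k + m.choose (k + 1) : ℕ) : ℂ) *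
        n.choose (k + 1) * z ^ (k + 1) -
      ∑ k ∈ Finset.range (n + 1), (m.choose (k + 1) : ℂ) * n.choose (k + 1) * z ^ (k + 1) +
      ∑ k ∈ Finset.range (n + 1), (m.choose k : ℂ) * n.choose k * z ^ (k + 1) := by
    simp only [← Finset.sum_add_distrib, ← Finset.sum_sub_distrib]
    refine Finset.sum_congr rfl fun k _ ↦ ?_
    push_cast
    ring
  simp only [Nat.succ_eq_add_one]
  rw [this]
  ring

/-- The generating function of the overlap of `s` orders with independent random sides. -/
noncomputable def overlapGen (z a b : ℂ) (s : ℕ) : ℂ :=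
  ∑ p ∈ Finset.HasAntidiagonal.antidiagonal s, a ^ p.1 * b ^ p.2 * overlapPoly z p.1 p.2

lemma overlapGen_add_two (z : ℂ) {a b : ℂ} (hab : a + b = 1) (s : ℕ) :
    overlapGen z a b (s + 2) =
      overlapGen z a b (s + 1) - (1 - z) * (a * b) * overlapGen z a b s := by
  have h2 : overlapGen z a b (s + 2) = b ^ (s + 2) + (a ^ (s + 2) +
      ∑ p ∈ Finset.HasAntidiagonal.antidiagonal s,
        a ^ (p.1 + 1) * b ^ (p.2 + 1) * overlapPoly z (p.1 + 1) (p.2 + 1)) := by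
    rw [overlapGen, Finset.Nat.sum_antidiagonal_succ, Finset.Nat.sum_antidiagonal_succ']
    simp [overlapPoly_zero_left, overlapPoly_zero_right]
  have ha : overlapGen z a b (s + 1) = a ^ (s + 1) + ∑ p ∈ Finset.HasAntidiagonal.antidiagonal s,
      a ^ p.1 * b ^ (p.2 + 1) * overlapPoly z p.1 (p.2 + 1) := by
    rw [overlapGen, Finset.Nat.sum_antidiagonal_succ']
    simp [overlapPoly_zero_right]
  have hb : overlapGen z a b (s + 1) = b ^ (s + 1) + ∑ p ∈ Finset.HasAntidiagonal.antidiagonal s,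
      a ^ (p.1 + 1) * b ^ p.2 * overlapPoly z (p.1 + 1) p.2 := by
    rw [overlapGen, Finset.Nat.sum_antidiagonal_succ]
    simp [overlapPoly_zero_left]
  have hsplit : overlapGen z a b (s + 1) =
      a * overlapGen z a b (s + 1) + b * overlapGen z a b (s + 1) := by
    rw [← add_mul, hab, one_mul]
  rw [hsplit, h2]
  nth_rw 1 [ha]
  rw [hb, overlapGen]
  have hsum : ∑ p ∈ Finset.HasAntidiagonal.antidiagonal s,
        a ^ (p.1 + 1) * b ^ (p.2 + 1) * overlapPoly z (p.1 + 1) (p.2 + 1) =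
      a * ∑ p ∈ Finset.HasAntidiagonal.antidiagonal s, a ^ p.1 * b ^ (p.2 + 1) * overlapPoly z p.1 (p.2 + 1) +
      b * ∑ p ∈ Finset.HasAntidiagonal.antidiagonal s, a ^ (p.1 + 1) * b ^ p.2 * overlapPoly z (p.1 + 1) p.2 -
      (1 - z) * (a * b) *
        ∑ p ∈ Finset.HasAntidiagonal.antidiagonal s, a ^ p.1 * b ^ p.2 * overlapPoly z p.1 p.2 := by
    simp only [Finset.mul_sum, ← Finset.sum_add_distrib, ← Finset.sum_sub_distrib]
    refine Finset.sum_congr rfl fun p _ ↦ ?_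
    rw [overlapPoly_succ_succ]
    ring
  rw [hsum]
  ring

lemma sub_mul_overlapGen {z a b r t : ℂ} (hab : a + b = 1) (hadd : r + t = 1)
    (hmul : r * t = (1 - z) * (a * b)) (s : ℕ) :
    (r - t) * overlapGen z a b s = r ^ (s + 1) - t ^ (s + 1) := by
  induction s using Nat.twoStepInduction with
  | zero => simp [overlapGen, overlapPoly]
  | one =>
    have : overlapGen z a b 1 = a + b := by
      simp [overlapGen, Finset.Nat.antidiagonal_succ, overlapPoly_zero_left,
        overlapPoly_zero_right, add_comm]
    rw [this, hab, ← hadd]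
    ring
  | more s ih0 ih1 =>
    rw [overlapGen_add_two z hab, ← hmul, mul_sub, ih1, mul_left_comm, ih0]
    linear_combination (t ^ (s + 2) - r ^ (s + 2)) * hadd

/-- The Poisson mixture of `overlapGen`. -/
lemma hasSum_poisson_overlapGen {z a b r t : ℂ} (hab : a + b = 1) (hadd : r + t = 1)
    (hmul : r * t = (1 - z) * (a * b)) (L : ℂ) :
    HasSum (fun s : ℕ ↦ (r - t) *
        (Complex.exp (-L) * L ^ s / (s.factorial : ℂ) * overlapGen z a b s))
      (r * Complex.exp (-(L * t)) - t * Complex.exp (-(L * r))) := by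
  have hexp (c : ℂ) : HasSum (fun s : ℕ ↦ c * Complex.exp (-L) * ((L * c) ^ s / s.factorial))
      (c * Complex.exp (-L) * Complex.exp (L * c)) := by
    refine HasSum.mul_left _ ?_
    rw [Complex.exp_eq_exp_ℂ]
    exact NormedSpace.expSeries_div_hasSum_exp (L * c)
  have hval : r * Complex.exp (-(L * t)) - t * Complex.exp (-(L * r)) =
      r * Complex.exp (-L) * Complex.exp (L * r) - t * Complex.exp (-L) * Complex.exp (L * t) := by
    rw [mul_assoc, mul_assoc, ← Complex.exp_add, ← Complex.exp_add,
      show -L + L * r = -(L * t) by linear_combination L * hadd,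
      show -L + L * t = -(L * r) by linear_combination L * hadd]
  have hterm (s : ℕ) :
      (r - t) * (Complex.exp (-L) * L ^ s / (s.factorial : ℂ) * overlapGen z a b s) =
        r * Complex.exp (-L) * ((L * r) ^ s / s.factorial) -
          t * Complex.exp (-L) * ((L * t) ^ s / s.factorial) := by
    rw [mul_left_comm, sub_mul_overlapGen hab hadd hmul]
    ring
  rw [hval]
  simp_rw [hterm]
  exact (hexp r).sub (hexp t)

/-- Joint mass of `M = m`, `N = n`, `V = k`, for Poisson parameters `α L` and `(1 - α) L`. -/
noncomputable def auctionMass (L α : ℝ) (m n k : ℕ) : ℝ :=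
  Real.exp (-L) * L ^ (m + n) / ((m + n).factorial : ℝ) *
    (α ^ m * (1 - α) ^ n * ((m.choose k : ℝ) * n.choose k))

lemma auctionMass_nonneg {L α : ℝ} (hL : 0 ≤ L) (hα : α ∈ Set.Ioo (0 : ℝ) 1) (m n k : ℕ) :
    0 ≤ auctionMass L α m n k := by
  have := hα.1.le
  have : 0 ≤ 1 - α := sub_nonneg.2 hα.2.le
  unfold auctionMass
  positivity

lemma poisson_mul_poisson_mul_hypergeometric (L α : ℝ) (m n k : ℕ) :
    Real.exp (-(α * L)) * (α * L) ^ m / (m.factorial : ℝ) *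
      (Real.exp (-((1 - α) * L)) * ((1 - α) * L) ^ n / (n.factorial : ℝ)) *
      (((m.choose k : ℝ) * (n.choose k : ℝ)) / (((m + n).choose n : ℝ))) =
      auctionMass L α m n k := by
  have hexp : Real.exp (-(α * L)) * Real.exp (-((1 - α) * L)) = Real.exp (-L) := by
    rw [← Real.exp_add]
    ring_nf
  have hchoose : ((m + n).choose n : ℝ) * (m.factorial * n.factorial) = (m + n).factorial := by
    have h := Nat.add_choose_mul_factorial_mul_factorial m n
    rw [mul_assoc] at h
    exact_mod_cast h
  have h1 : ((m + n).choose n : ℝ) ≠ 0 := by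
    exact_mod_cast (Nat.choose_pos (Nat.le_add_left n m)).ne'
  have h2 : (m.factorial : ℝ) ≠ 0 := by positivity
  have h3 : (n.factorial : ℝ) ≠ 0 := by positivity
  rw [auctionMass, ← hexp, ← hchoose, mul_pow, mul_pow]
  field_simp
  ring

lemma sum_choose_mul_choose_div (m n : ℕ) :
    ∑ k ∈ Finset.range (n + 1),
      ((m.choose k : ℝ) * (n.choose k : ℝ)) / (((m + n).choose n : ℝ)) = 1 := by
  have h : ∑ k ∈ Finset.range (n + 1), m.choose k * n.choose k = (m + n).choose n := by
    rw [Nat.add_choose_eq, Finset.Nat.sum_antidiagonal_eq_sum_range_succ_mk]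
    refine Finset.sum_congr rfl fun k hk ↦ ?_
    rw [Nat.choose_symm (Nat.lt_succ_iff.1 (Finset.mem_range.1 hk))]
  have h1 : ((m + n).choose n : ℝ) ≠ 0 := by
    exact_mod_cast (Nat.choose_pos (Nat.le_add_left n m)).ne'
  rw [← Finset.sum_div, div_eq_one_iff_eq h1]
  exact_mod_cast h

lemma tsum_ofReal_poisson {r : ℝ} (hr : 0 ≤ r) :
    ∑' n : ℕ, ENNReal.ofReal (Real.exp (-r) * r ^ n / (n.factorial : ℝ)) = 1 := by
  have h := hasSum_one_poissonMeasure ⟨r, hr⟩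
  change HasSum (fun n : ℕ ↦ Real.exp (-r) * r ^ n / (n.factorial : ℝ)) 1 at h
  rw [← ENNReal.ofReal_tsum_of_nonneg (fun n ↦ by positivity) h.summable, h.tsum_eq,
    ENNReal.ofReal_one]

lemma tsum_ofReal_hypergeometric (m n : ℕ) :
    ∑' k : ℕ, ENNReal.ofReal (((m.choose k : ℝ) * (n.choose k : ℝ)) / (((m + n).choose n : ℝ)))
      = 1 := by
  rw [tsum_eq_sum (s := Finset.range (n + 1)), ← ENNReal.ofReal_sum_of_nonneg,
    sum_choose_mul_choose_div, ENNReal.ofReal_one]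
  · intro k _
    positivity
  · intro k hk
    rw [Nat.choose_eq_zero_of_lt (by simpa using hk : n < k)]
    simp

section

variable {Ω : Type*} [MeasurableSpace Ω] (μ : Measure Ω) [IsProbabilityMeasure μ] {M N V : Ω → ℕ}
  {L α : ℝ}

/-- The generating function of the traded volume on the unit circle, in closed form. -/
lemma sub_mul_integral_pow_volume (hL : 0 ≤ L) (hα : α ∈ Set.Ioo (0 : ℝ) 1)
    (hY : AEMeasurable (fun ω ↦ ((M ω, N ω), V ω)) μ)
    (hmass : ∀ m n k, μ {ω | V ω = k ∧ M ω = m ∧ N ω = n} =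
      ENNReal.ofReal (auctionMass L α m n k))
    {z r t : ℂ} (hz : ‖z‖ = 1) (hadd : r + t = 1) (hmul : r * t = (1 - z) * (α * (1 - α))) :
    (r - t) * ∫ ω, z ^ V ω ∂μ =
      r * Complex.exp (-(L * t)) - t * Complex.exp (-(L * r)) := by
  set ν := μ.map fun ω ↦ ((M ω, N ω), V ω) with hν
  have : IsProbabilityMeasure ν := Measure.isProbabilityMeasure_map hY
  let f : (ℕ × ℕ) × ℕ → ℂ := fun p ↦ z ^ p.2
  have hf : Integrable f ν :=
    .of_bound (Measurable.of_discrete (f := f)).aestronglyMeasurable 1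
      (ae_of_all _ fun p ↦ by simp [f, hz])
  have hνreal (p : (ℕ × ℕ) × ℕ) : ν.real {p} = auctionMass L α p.1.1 p.1.2 p.2 := by
    rw [measureReal_def, hν, Measure.map_apply_of_aemeasurable hY (measurableSet_singleton p),
      show (fun ω ↦ ((M ω, N ω), V ω)) ⁻¹' {p} =
        {ω | V ω = p.2 ∧ M ω = p.1.1 ∧ N ω = p.1.2} by ext; simp [Prod.ext_iff, and_comm],
      hmass, ENNReal.toReal_ofReal (auctionMass_nonneg hL hα _ _ _)]
  have hsum : HasSum (fun p ↦ (ν.real {p} : ℂ) * f p) (∫ ω, z ^ V ω ∂μ) := by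
    have hint : ∫ ω, z ^ V ω ∂μ = ∫ p, f p ∂ν :=
      (integral_map hY (Measurable.of_discrete (f := f)).aestronglyMeasurable).symm
    have h := hasSum_integral_measure (μ := fun p ↦ ν {p} • Measure.dirac p) (f := f)
      (by rwa [Measure.sum_smul_dirac])
    rw [Measure.sum_smul_dirac, ← hint] at h
    simpa [integral_smul_measure, measureReal_def] using h
  have hpairs : HasSum (fun p : ℕ × ℕ ↦ Complex.exp (-L) * L ^ (p.1 + p.2) /
      ((p.1 + p.2).factorial : ℂ) * ((α : ℂ) ^ p.1 * (1 - α : ℂ) ^ p.2 * overlapPoly z p.1 p.2))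
      (∫ ω, z ^ V ω ∂μ) := by
    refine hsum.prod_fiberwise fun p ↦ ?_
    have : Complex.exp (-L) * L ^ (p.1 + p.2) /
        ((p.1 + p.2).factorial : ℂ) * ((α : ℂ) ^ p.1 * (1 - α : ℂ) ^ p.2 * overlapPoly z p.1 p.2) =
        ∑ k ∈ Finset.range (p.2 + 1), (ν.real {(p, k)} : ℂ) * f (p, k) := by
      simp only [hνreal, auctionMass, overlapPoly, Finset.mul_sum, f]
      refine Finset.sum_congr rfl fun k _ ↦ ?_
      push_cast
      ring
    rw [this]
    refine hasSum_sum_of_ne_finset_zero fun k hk ↦ ?_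
    rw [hνreal, auctionMass, Nat.choose_eq_zero_of_lt (by simpa using hk : p.2 < k)]
    simp
  have htotal : HasSum (fun s : ℕ ↦ Complex.exp (-L) * L ^ s / (s.factorial : ℂ) *
      overlapGen z α (1 - α) s) (∫ ω, z ^ V ω ∂μ) := by
    rw [← Finset.HasAntidiagonal.sigmaAntidiagonalEquivProd.hasSum_iff] at hpairs
    refine hpairs.sigma fun s ↦ ?_
    have : Complex.exp (-L) * L ^ s / (s.factorial : ℂ) * overlapGen z α (1 - α) s =
        ∑ p : Finset.HasAntidiagonal.antidiagonal s, Complex.exp (-L) * L ^ (p.1.1 + p.1.2) /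
          ((p.1.1 + p.1.2).factorial : ℂ) *
            ((α : ℂ) ^ p.1.1 * (1 - α : ℂ) ^ p.1.2 * overlapPoly z p.1.1 p.1.2) := by
      rw [overlapGen, Finset.mul_sum, ← Finset.sum_coe_sort]
      refine Finset.sum_congr rfl fun p _ ↦ ?_
      rw [Finset.HasAntidiagonal.mem_antidiagonal.1 p.2]
    rw [this]
    exact hasSum_fintype _
  exact (htotal.mul_left (r - t)).unique
    (hasSum_poisson_overlapGen (add_sub_cancel _ _) hadd hmul L)

end

lemma tendsto_exp_sub_one_div : Tendsto (fun x : ℂ ↦ (Complex.exp x - 1) / x) (𝓝[≠] 0) (𝓝 1) := by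
  have h := hasDerivAt_iff_tendsto_slope_zero.1 (Complex.hasDerivAt_exp 0)
  simpa [div_eq_inv_mul] using h

lemma tendsto_exp_sub_one_sub_div_sq :
    Tendsto (fun x : ℂ ↦ (Complex.exp x - 1 - x) / x ^ 2) (𝓝[≠] 0) (𝓝 (1 / 2)) := by
  have h := ((Complex.exp_sub_sum_range_isBigO_pow 3).trans_isLittleO
    (Asymptotics.isLittleO_pow_pow (𝕜 := ℂ) (show 2 < 3 by norm_num))).tendsto_div_nhds_zero
  have h' := (h.mono_left (nhdsWithin_le_nhds (s := {0}ᶜ))).add_const (1 / 2)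
  rw [zero_add] at h'
  refine h'.congr' ?_
  filter_upwards [self_mem_nhdsWithin] with x hx
  have hx0 : x ≠ 0 := hx
  simp only [Finset.sum_range_succ, Finset.sum_range_zero, Nat.factorial]
  field_simp
  push_cast
  ring

/-- The root near `1` of `r (1 - r) = (1 - eˣ) p`, with the second order expansion of `1 - r`. -/
lemma exists_root_expansion (p : ℂ) :
    ∃ r : ℂ → ℂ, (∀ x, r x * (1 - r x) = (1 - Complex.exp x) * p) ∧
      Tendsto r (𝓝[≠] 0) (𝓝 1) ∧
      Tendsto (fun x ↦ (x * p + (1 - r x)) / x ^ 2) (𝓝[≠] 0) (𝓝 (p ^ 2 - p / 2)) := by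
  let q : ℂ → ℂ := fun x ↦ (1 - 4 * ((1 - Complex.exp x) * p)) ^ (1 / 2 : ℂ)
  have hq (x : ℂ) : q x ^ 2 = 1 - 4 * ((1 - Complex.exp x) * p) := by
    simp only [q, one_div]
    exact Complex.cpow_nat_inv_pow _ two_ne_zero
  have hq1 : Tendsto q (𝓝[≠] 0) (𝓝 1) := by
    have hc : ContinuousAt q 0 := by
      refine ContinuousAt.cpow (by fun_prop) continuousAt_const ?_
      simp
    simpa [q] using hc.tendsto.mono_left nhdsWithin_le_nhds
  have hroot (x : ℂ) : (1 + q x) / 2 * (1 - (1 + q x) / 2) = (1 - Complex.exp x) * p := by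
    linear_combination (-1 / 4) * hq x
  have hr : Tendsto (fun x ↦ (1 + q x) / 2) (𝓝[≠] 0) (𝓝 1) := by
    have := (hq1.const_add 1).div_const 2
    norm_num at this
    exact this
  refine ⟨fun x ↦ (1 + q x) / 2, hroot, hr, ?_⟩
  have hlim := ((tendsto_exp_sub_one_sub_div_sq.const_mul (-p))).add
    (((tendsto_exp_sub_one_div.pow 2).mul_const (p ^ 2)).div (hr.pow 2) (by norm_num))
  have hval : -p * (1 / 2) + 1 ^ 2 * p ^ 2 / 1 ^ 2 = p ^ 2 - p / 2 := by ring
  rw [hval] at hlim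
  refine hlim.congr' ?_
  filter_upwards [self_mem_nhdsWithin, hr.eventually_ne one_ne_zero] with x hx hr0
  have hx0 : x ≠ 0 := hx
  simp only [Pi.div_apply]
  have h := hroot x
  generalize (1 + q x) / 2 = r at hr0 h ⊢
  have hsq : ((Complex.exp x - 1) / x) ^ 2 * p ^ 2 / r ^ 2 = (1 - r) ^ 2 / x ^ 2 := by
    rw [div_pow, div_mul_eq_mul_div, div_div,
      div_eq_div_iff (mul_ne_zero (pow_ne_zero 2 hx0) (pow_ne_zero 2 hr0)) (pow_ne_zero 2 hx0)]
    linear_combination -(r * (1 - r) + (1 - Complex.exp x) * p) * x ^ 2 * h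
  rw [hsq, ← mul_div_assoc, ← add_div]
  congr 1
  linear_combination -h

lemma tendsto_normalized_volume_genFun {p t : ℝ} (hp : 0 < p) (hσ : 0 < 1 - 2 * p) (ht : t ≠ 0)
    {L : ℕ → ℝ} (hL0 : ∀ n, 0 < L n) (hL : Tendsto L atTop atTop) {r : ℂ → ℂ} {x E : ℕ → ℂ}
    (hr : Tendsto r (𝓝[≠] 0) (𝓝 1))
    (hexp : Tendsto (fun x ↦ (x * p + (1 - r x)) / x ^ 2) (𝓝[≠] 0) (𝓝 ((p : ℂ) ^ 2 - p / 2)))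
    (hx : ∀ n, x n = (t / √(L n * p * (1 - 2 * p)) : ℝ) * Complex.I)
    (hE : ∀ n, (r (x n) - (1 - r (x n))) * E n = r (x n) * Complex.exp (-(L n * (1 - r (x n)))) -
      (1 - r (x n)) * Complex.exp (-(L n * r (x n)))) :
    Tendsto (fun n ↦ Complex.exp (-(x n * L n * p)) * E n) atTop
      (𝓝 (Complex.exp (-t ^ 2 / 2))) := by
  have hsq (n : ℕ) : 0 < L n * p * (1 - 2 * p) := mul_pos (mul_pos (hL0 n) hp) hσ
  have hx_ne (n : ℕ) : x n ≠ 0 := by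
    rw [hx]
    refine mul_ne_zero ?_ Complex.I_ne_zero
    exact_mod_cast div_ne_zero ht (Real.sqrt_pos.2 (hsq n)).ne'
  have hx_sq (n : ℕ) : x n ^ 2 * (L n * p * (1 - 2 * p)) = -t ^ 2 := by
    rw [hx, mul_pow, Complex.I_sq]
    have h : (t / √(L n * p * (1 - 2 * p))) ^ 2 * (L n * p * (1 - 2 * p)) = t ^ 2 := by
      rw [div_pow, Real.sq_sqrt (hsq n).le, div_mul_cancel₀ _ (hsq n).ne']
    have h' := congrArg (fun y : ℝ ↦ (y : ℂ)) h
    push_cast at h' ⊢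
    linear_combination -h'
  have hx0 : Tendsto x atTop (𝓝[≠] 0) := by
    refine tendsto_nhdsWithin_iff.2 ⟨?_, Eventually.of_forall hx_ne⟩
    have hsqrt : Tendsto (fun n ↦ √(L n * p * (1 - 2 * p))) atTop atTop :=
      Real.tendsto_sqrt_atTop.comp ((hL.atTop_mul_const hp).atTop_mul_const hσ)
    have h := (Complex.continuous_ofReal.tendsto _).comp (hsqrt.const_div_atTop t)
    have h' := h.mul_const Complex.I
    simp only [Complex.ofReal_zero, zero_mul] at h'
    exact h'.congr fun n ↦ (hx n).symm
  have hrx : Tendsto (fun n ↦ r (x n)) atTop (𝓝 1) := hr.comp hx0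
  have hp' : (p : ℂ) ≠ 0 := by exact_mod_cast hp.ne'
  have hσ' : (1 - 2 * p : ℂ) ≠ 0 := by exact_mod_cast hσ.ne'
  have hmain : Tendsto (fun n ↦ Complex.exp (-(L n * (x n * p + (1 - r (x n)))))) atTop
      (𝓝 (Complex.exp (-t ^ 2 / 2))) := by
    have h := ((hexp.comp hx0).const_mul (t ^ 2 / (p * (1 - 2 * p)) : ℂ)).cexp
    have hval : (t ^ 2 / (p * (1 - 2 * p)) : ℂ) * (p ^ 2 - p / 2) = -t ^ 2 / 2 := by
      have hc : (p * (1 - 2 * p) : ℂ) ≠ 0 := mul_ne_zero hp' hσ'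
      rw [show (p ^ 2 - p / 2 : ℂ) = -(p * (1 - 2 * p)) / 2 by ring]
      generalize (p * (1 - 2 * p) : ℂ) = c at hc
      field_simp
    rw [hval] at h
    refine h.congr fun n ↦ congrArg Complex.exp ?_
    have hL' : (L n : ℂ) = -(t ^ 2 / (p * (1 - 2 * p))) / x n ^ 2 := by
      rw [eq_div_iff (pow_ne_zero 2 (hx_ne n)), ← neg_div, eq_div_iff (mul_ne_zero hp' hσ')]
      linear_combination hx_sq n
    simp only [Function.comp_apply]
    rw [hL']
    ring
  have hsmall : Tendsto (fun n ↦ (1 - r (x n)) *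
      Complex.exp (-(x n * L n * p) - L n * r (x n))) atTop (𝓝 0) := by
    have hre : ∀ᶠ n in atTop, 0 < (r (x n)).re :=
      ((Complex.continuous_re.tendsto _).comp hrx).eventually_const_lt (by simp)
    have h1 : Tendsto (fun n ↦ ‖1 - r (x n)‖) atTop (𝓝 0) := by
      simpa using (hrx.const_sub 1).norm
    refine squeeze_zero_norm' ?_ h1
    filter_upwards [hre] with n hn
    rw [norm_mul, Complex.norm_exp]
    refine mul_le_of_le_one_right (norm_nonneg _) (Real.exp_le_one_iff.2 ?_)
    have hx_re : (x n * L n * p).re = 0 := by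
      rw [hx]
      simp
    rw [Complex.sub_re, Complex.neg_re, hx_re, Complex.re_ofReal_mul]
    linarith [mul_pos (hL0 n) hn]
  have hden : Tendsto (fun n ↦ r (x n) - (1 - r (x n))) atTop (𝓝 1) := by
    simpa using hrx.sub (hrx.const_sub 1)
  have hlim := ((hrx.mul hmain).sub hsmall).div hden one_ne_zero
  rw [one_mul, sub_zero, div_one] at hlim
  refine hlim.congr' ?_
  filter_upwards [hden.eventually_ne one_ne_zero] with n hn
  simp only [Pi.div_apply]
  rw [div_eq_iff hn,
    show -(L n * (x n * p + (1 - r (x n)))) = -(x n * L n * p) + -(L n * (1 - r (x n))) by ring,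
    sub_eq_add_neg (-(x n * L n * p)), Complex.exp_add, Complex.exp_add]
  linear_combination (-Complex.exp (-(x n * L n * p))) * hE n

lemma aemeasurable_orders {Ω : Type*} [MeasurableSpace Ω] (μ : Measure Ω) [IsProbabilityMeasure μ]
    {M N V : Ω → ℕ} {p q : ℕ → ENNReal} {h : ℕ → ℕ → ℕ → ENNReal}
    (hmass : ∀ m n k, μ {ω | V ω = k ∧ M ω = m ∧ N ω = n} = p m * q n * h m n k)
    (hp : ∑' m, p m = 1) (hq : ∑' n, q n = 1) (hh : ∀ m n, ∑' k, h m n k = 1) :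
    AEMeasurable (fun ω ↦ ((M ω, N ω), V ω)) μ := by
  refine aemeasurable_of_tsum_measure_fiber_le μ _ (le_of_eq ?_)
  have hfib (x : (ℕ × ℕ) × ℕ) : μ ((fun ω ↦ ((M ω, N ω), V ω)) ⁻¹' {x}) =
      p x.1.1 * q x.1.2 * h x.1.1 x.1.2 x.2 := by
    rw [← hmass]
    congr 1
    ext
    simp [Prod.ext_iff, and_comm]
  simp_rw [hfib]
  rw [ENNReal.tsum_prod', ENNReal.tsum_prod']
  simp [ENNReal.tsum_mul_left, hp, hq, hh]

lemma charFun_map_normalized {Ω : Type*} [MeasurableSpace Ω] (μ : Measure Ω) {V : Ω → ℕ}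
    (hV : AEMeasurable V μ) (c S t : ℝ) :
    charFun (μ.map fun ω ↦ ((V ω : ℝ) - c) / S) t =
      Complex.exp (-((t / S : ℝ) * Complex.I * c)) *
        ∫ ω, Complex.exp ((t / S : ℝ) * Complex.I) ^ V ω ∂μ := by
  have hX : AEMeasurable (fun ω ↦ ((V ω : ℝ) - c) / S) μ :=
    (Measurable.of_discrete (f := fun k : ℕ ↦ ((k : ℝ) - c) / S)).comp_aemeasurable hV
  rw [charFun_apply_real, integral_map hX (by fun_prop), ← integral_const_mul]
  refine integral_congr_ae (ae_of_all _ fun ω ↦ ?_)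
  simp only
  rw [← Complex.exp_nat_mul, ← Complex.exp_add]
  congr 1
  push_cast
  ring

/-- Fix `α ∈ (0,1)`, `θ > 0` and `T > 0`, and set
`μ_λ = (λ/θ)(1 − e^{−θT})`.  For each `λ > 0`, let `M_λ` and `N_λ` be independent Poisson
random variables with parameters `α μ_λ` and `(1−α) μ_λ`, and let `V_λ` have conditional
hypergeometric law `P(V_λ = k | M_λ = m, N_λ = n) = C(m,k)C(n,k)/C(m+n,n)`.  Then, as
`λ → ∞`, `(V_λ − μ_λ α(1−α)) / sqrt(μ_λ α(1−α)(1 − 2α(1−α)))` converges in distribution to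
the standard normal law: the traded volume of the call auction with cancellation rate `θ` is
asymptotically normal with mean `(λ/θ)(1−e^{−θT}) α(1−α)` and standard deviation
`sqrt((λ/θ)(1−e^{−θT}) α(1−α)(1−2α(1−α)))`. -/
theorem stmt_18 {Ω : Type*} [MeasurableSpace Ω] (μ : Measure Ω) [IsProbabilityMeasure μ]
    (α θ T : ℝ) (hα : α ∈ Set.Ioo (0 : ℝ) 1) (hθ : 0 < θ) (hT : 0 < T)
    (lamMass : ℝ → ℝ) (hmass : ∀ lam : ℝ, lamMass lam = lam / θ * (1 - Real.exp (-(θ * T))))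
    (M N V : ℝ → Ω → ℕ)
    (hM : ∀ lam : ℝ, 0 < lam → ∀ m : ℕ,
      μ {ω | M lam ω = m}
        = ENNReal.ofReal
            (Real.exp (-(α * lamMass lam)) * (α * lamMass lam) ^ m / (m.factorial : ℝ)))
    (hN : ∀ lam : ℝ, 0 < lam → ∀ n : ℕ,
      μ {ω | N lam ω = n}
        = ENNReal.ofReal
            (Real.exp (-((1 - α) * lamMass lam)) * ((1 - α) * lamMass lam) ^ n /
              (n.factorial : ℝ)))
    (hindep : ∀ lam : ℝ, 0 < lam → ∀ m n : ℕ,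
      μ {ω | M lam ω = m ∧ N lam ω = n} = μ {ω | M lam ω = m} * μ {ω | N lam ω = n})
    (hV : ∀ lam : ℝ, 0 < lam → ∀ m n k : ℕ,
      μ {ω | V lam ω = k ∧ M lam ω = m ∧ N lam ω = n}
        = μ {ω | M lam ω = m ∧ N lam ω = n} *
            ENNReal.ofReal (((m.choose k : ℝ) * (n.choose k : ℝ)) / (((m + n).choose n : ℝ)))) :
    ∀ x : ℝ,
      Tendsto (fun lam : ℝ =>
          (μ {ω | ((V lam ω : ℝ) - lamMass lam * (α * (1 - α))) /
              Real.sqrt (lamMass lam * (α * (1 - α)) * (1 - 2 * (α * (1 - α)))) ≤ x}).toReal)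
        atTop (𝓝 ((gaussianReal 0 1 (Set.Iic x)).toReal)) := by
  intro x
  set p : ℝ := α * (1 - α) with hp_def
  have hα1 : 0 < 1 - α := sub_pos.2 hα.2
  have hp : 0 < p := mul_pos hα.1 hα1
  have hσ : 0 < 1 - 2 * p := by
    rw [hp_def]
    nlinarith [sq_nonneg (1 - 2 * α)]
  have hrate : 0 < (1 - Real.exp (-(θ * T))) / θ :=
    div_pos (sub_pos.2 (Real.exp_lt_one_iff.2 (neg_neg_of_pos (mul_pos hθ hT)))) hθ
  have hmass' (lam : ℝ) : lamMass lam = lam * ((1 - Real.exp (-(θ * T))) / θ) := by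
    rw [hmass]
    ring
  have hL0 {lam : ℝ} (h : 0 < lam) : 0 < lamMass lam := by
    rw [hmass']
    exact mul_pos h hrate
  have hLtop : Tendsto lamMass atTop atTop := by
    rw [funext hmass']
    exact tendsto_id.atTop_mul_const hrate
  have hjoint {lam : ℝ} (h : 0 < lam) (m n k : ℕ) :
      μ {ω | V lam ω = k ∧ M lam ω = m ∧ N lam ω = n} =
        ENNReal.ofReal (auctionMass (lamMass lam) α m n k) := by
    have h1 : 0 ≤ α * lamMass lam := (mul_pos hα.1 (hL0 h)).le
    have h2 : 0 ≤ (1 - α) * lamMass lam := (mul_pos hα1 (hL0 h)).le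
    rw [hV lam h, hindep lam h, hM lam h, hN lam h,
      ← poisson_mul_poisson_mul_hypergeometric, ENNReal.ofReal_mul (by positivity),
      ENNReal.ofReal_mul (by positivity)]
  have hY {lam : ℝ} (h : 0 < lam) :
      AEMeasurable (fun ω ↦ ((M lam ω, N lam ω), V lam ω)) μ := by
    refine aemeasurable_orders μ (fun m n k ↦ ?_)
      (tsum_ofReal_poisson (mul_pos hα.1 (hL0 h)).le)
      (tsum_ofReal_poisson (mul_pos hα1 (hL0 h)).le) tsum_ofReal_hypergeometric
    rw [hV lam h, hindep lam h, hM lam h, hN lam h]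
  have hVm {lam : ℝ} (h : 0 < lam) : AEMeasurable (V lam) μ :=
    measurable_snd.comp_aemeasurable (hY h)
  refine tendsto_of_seq_tendsto fun v hv ↦ ?_
  let u : ℕ → ℝ := fun n ↦ max (v n) 1
  have hu0 (n : ℕ) : 0 < u n := lt_max_of_lt_right one_pos
  have huv : ∀ᶠ n in atTop, u n = v n :=
    (hv.eventually_ge_atTop 1).mono fun n hn ↦ max_eq_left hn
  have hu : Tendsto u atTop atTop := hv.congr' (huv.mono fun n hn ↦ hn.symm)
  let X : ℕ → Ω → ℝ := fun n ω ↦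
    ((V (u n) ω : ℝ) - lamMass (u n) * p) / √(lamMass (u n) * p * (1 - 2 * p))
  have hX (n : ℕ) : AEMeasurable (X n) μ :=
    (Measurable.of_discrete (f := fun k : ℕ ↦ ((k : ℝ) - lamMass (u n) * p) /
      √(lamMass (u n) * p * (1 - 2 * p)))).comp_aemeasurable (hVm (hu0 n))
  let law : ℕ → ProbabilityMeasure ℝ := fun n ↦
    ⟨μ.map (X n), Measure.isProbabilityMeasure_map (hX n)⟩
  let gaussian : ProbabilityMeasure ℝ := ⟨gaussianReal 0 1, inferInstance⟩
  have hlaw : Tendsto law atTop (𝓝 gaussian) := by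
    refine ProbabilityMeasure.tendsto_of_tendsto_charFun fun t ↦ ?_
    obtain rfl | ht := eq_or_ne t 0
    · simp
    have hpc : (p : ℂ) = α * (1 - α) := by
      rw [hp_def]
      push_cast
      rfl
    obtain ⟨r, hr_root, hr_one, hr_exp⟩ := exists_root_expansion (p : ℂ)
    have hlim := tendsto_normalized_volume_genFun (p := p) hp hσ ht (fun n ↦ hL0 (hu0 n))
      (hLtop.comp hu)
      (x := fun n ↦ (t / √(lamMass (u n) * p * (1 - 2 * p)) : ℝ) * Complex.I)
      hr_one hr_exp (fun n ↦ rfl)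
      (fun n ↦ sub_mul_integral_pow_volume μ (hL0 (hu0 n)).le hα (hY (hu0 n)) (hjoint (hu0 n))
        (Complex.norm_exp_ofReal_mul_I (t / √(lamMass (u n) * p * (1 - 2 * p))))
        (add_sub_cancel _ _)
        ((hr_root _).trans (by rw [hpc])))
    change Tendsto (fun n ↦ charFun (μ.map (X n)) t) atTop (𝓝 (charFun (gaussianReal 0 1) t))
    rw [charFun_gaussianReal]
    convert hlim using 2 with n
    · rw [charFun_map_normalized μ (hVm (hu0 n))]
      congr 2
      push_cast
      ring
    · congr 1
      push_cast
      ring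
  have hcdf := ProbabilityMeasure.tendsto_measure_of_null_frontier_of_tendsto' hlaw
    (E := Set.Iic x) (by
      rw [frontier_Iic]
      have := nullSingletonClass_gaussianReal (μ := 0) one_ne_zero
      exact measure_singleton (μ := gaussianReal 0 1) x)
  refine ((ENNReal.tendsto_toReal (measure_ne_top _ _)).comp hcdf).congr' ?_
  filter_upwards [huv] with n hn
  change (μ.map (X n) (Set.Iic x)).toReal = _
  rw [Measure.map_apply_of_aemeasurable (hX n) measurableSet_Iic, Function.comp_apply, ← hn]
  rfl
end

section
/- For all reals a, b > 0 with a ≠ b, the double series Σ_{m=0}^∞ Σ_{n=0}^∞ a^m b^n / (m+n)! converges and equals (a e^a − b e^b) / (a − b); equivalently, setting a = αt, b = (1−α)t with t > 0 and α ∈ (0,1), α ≠ 1/2, one obtains e^{−t} Σ_{m,n≥0} (αt)^m ((1−α)t)^n/(m+n)! = e^{−αt} + (α/(1−2α))(e^{−αt} − e^{−(1−α)t}). -/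
theorem sum_antidiagonal_pow_mul_pow {K : Type*} [Field K] {x y : K} (h : x ≠ y) (n : ℕ) :
    ∑ p ∈ Finset.HasAntidiagonal.antidiagonal n, x ^ p.1 * y ^ p.2 =
      (x * x ^ n - y * y ^ n) / (x - y) := by
  rw [Finset.Nat.sum_antidiagonal_eq_sum_range_succ (fun i j => x ^ i * y ^ j)]
  have := (Commute.all x y).geom_sum₂ h (n + 1)
  simpa [pow_succ'] using this

theorem hasSum_pow_mul_pow_div_factorial_add {x y : ℝ} (hx : 0 ≤ x) (hy : 0 ≤ y) (h : x ≠ y) :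
    HasSum (fun p : ℕ × ℕ => x ^ p.1 * y ^ p.2 / ((p.1 + p.2).factorial : ℝ))
      ((x * Real.exp x - y * Real.exp y) / (x - y)) := by
  have hexp (z : ℝ) : HasSum (fun n : ℕ => z ^ n / (n.factorial : ℝ)) (Real.exp z) := by
    rw [Real.exp_eq_exp_ℝ]
    exact NormedSpace.expSeries_div_hasSum_exp z
  have hdiag := (((hexp x).mul_left x).sub ((hexp y).mul_left y)).div_const (x - y)
  rw [← Finset.HasAntidiagonal.sigmaAntidiagonalEquivProd.hasSum_iff]
  have hfiber (n : ℕ) : HasSum (fun p : Finset.HasAntidiagonal.antidiagonal n =>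
      x ^ p.1.1 * y ^ p.1.2 / ((p.1.1 + p.1.2).factorial : ℝ))
      ((x * (x ^ n / (n.factorial : ℝ)) - y * (y ^ n / (n.factorial : ℝ))) / (x - y)) := by
    have hvalue : ∑ p ∈ Finset.HasAntidiagonal.antidiagonal n,
        x ^ p.1 * y ^ p.2 / ((p.1 + p.2).factorial : ℝ) =
        (x * (x ^ n / (n.factorial : ℝ)) - y * (y ^ n / (n.factorial : ℝ))) / (x - y) := by
      have hfactorial : ∀ p ∈ Finset.HasAntidiagonal.antidiagonal n,
          x ^ p.1 * y ^ p.2 / ((p.1 + p.2).factorial : ℝ) =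
            x ^ p.1 * y ^ p.2 / (n.factorial : ℝ) := fun p hp => by
        rw [Finset.HasAntidiagonal.mem_antidiagonal.mp hp]
      rw [Finset.sum_congr rfl hfactorial, ← Finset.sum_div, sum_antidiagonal_pow_mul_pow h]
      ring
    rw [← hvalue]
    exact (Finset.HasAntidiagonal.antidiagonal n).hasSum
      (fun p : ℕ × ℕ => x ^ p.1 * y ^ p.2 / ((p.1 + p.2).factorial : ℝ))
  refine HasSum.sigma_of_hasSum hdiag hfiber ?_
  refine (summable_sigma_of_nonneg fun p => ?_).mpr ⟨fun n => (hfiber n).summable, ?_⟩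
  · simp only [Function.comp_apply]
    positivity
  · exact hdiag.summable.congr fun n => ((hfiber n).tsum_eq).symm


/-- For all reals `a, b > 0` with `a ≠ b`, the double series
`Σ_{m,n≥0} a^m b^n/(m+n)!` converges and equals `(a e^a − b e^b)/(a − b)`; equivalently, with
`a = αt`, `b = (1−α)t` (`t > 0`, `α ∈ (0,1)`, `α ≠ 1/2`), one obtains
`e^{−t} Σ_{m,n≥0} (αt)^m ((1−α)t)^n/(m+n)! = e^{−αt} + (α/(1−2α))(e^{−αt} − e^{−(1−α)t})`. -/
theorem stmt_19 (a b : ℝ) (ha : 0 < a) (hb : 0 < b) (hab : a ≠ b) :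
    (Summable fun p : ℕ × ℕ => a ^ p.1 * b ^ p.2 / ((p.1 + p.2).factorial : ℝ)) ∧
    (∑' (p : ℕ × ℕ), a ^ p.1 * b ^ p.2 / ((p.1 + p.2).factorial : ℝ))
      = (a * Real.exp a - b * Real.exp b) / (a - b) ∧
    (∀ (t α : ℝ), 0 < t → α ∈ Set.Ioo (0 : ℝ) 1 → α ≠ 1 / 2 →
      Real.exp (-t) *
          (∑' (p : ℕ × ℕ), (α * t) ^ p.1 * ((1 - α) * t) ^ p.2 / ((p.1 + p.2).factorial : ℝ))
        = Real.exp (-(α * t)) +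
            α / (1 - 2 * α) * (Real.exp (-(α * t)) - Real.exp (-((1 - α) * t)))) := by
  have hab_sum := hasSum_pow_mul_pow_div_factorial_add ha.le hb.le hab
  refine ⟨hab_sum.summable, hab_sum.tsum_eq, fun t α ht hα hα_ne => ?_⟩
  obtain ⟨hα_pos, hα_lt⟩ := hα
  have hden : 1 - 2 * α ≠ 0 := fun h => hα_ne (by linarith)
  have hne : α * t ≠ (1 - α) * t := fun h => hden (by linarith [mul_right_cancel₀ ht.ne' h])
  rw [(hasSum_pow_mul_pow_div_factorial_add (by positivity)
    (mul_nonneg (by linarith) ht.le) hne).tsum_eq]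
  have hexp_fst : Real.exp (-((1 - α) * t)) = Real.exp (-t) * Real.exp (α * t) := by
    rw [← Real.exp_add]
    ring_nf
  have hexp_snd : Real.exp (-(α * t)) = Real.exp (-t) * Real.exp ((1 - α) * t) := by
    rw [← Real.exp_add]
    ring_nf
  have hsub : α * t - (1 - α) * t = -((1 - 2 * α) * t) := by ring
  have hden_comm : 1 - α * 2 ≠ 0 := by rwa [mul_comm α 2]
  rw [hexp_fst, hexp_snd, hsub]
  generalize Real.exp ((1 - α) * t) = u
  field_simp
  ring
end
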